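/- arXiv:2005.14166 — 11 statements merged into one kernel-verified Lean document; each statement's English description precedes it below -/
import Mathlib

section
/- Let (𝒮, 𝓔) be a GPT system. Then every frame function v on 𝓔 admits a representation v(e) = ⟨e, ω⟩ for some state ω ∈ 𝒮 (valid for all e ∈ 𝓔) if and only if cl(𝓔⁺) ∩ (u − cl(𝓔⁺)) = E(𝒮). In other words, a GPT system admits a Gleason-type theorem if and only if it is almost noisy unrestricted. -/
open scoped RealInnerProductSpace

/-- The unit effect vector `u = (0, …, 0, 1)` in `ℝ^{d+1}`. -/
noncomputable def unitEffect (d : ℕ) : EuclideanSpace ℝ (Fin (d + 1)) :=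
  EuclideanSpace.single (Fin.last d) 1

/-- The positive cone `A⁺ = {x • a : x ≥ 0, a ∈ A}`. -/
def posCone {d : ℕ} (A : Set (EuclideanSpace ℝ (Fin (d + 1)))) :
    Set (EuclideanSpace ℝ (Fin (d + 1))) :=
  {y | ∃ x : ℝ, 0 ≤ x ∧ ∃ a ∈ A, y = x • a}

/-- The dual cone `A* = {b : ⟨a, b⟩ ≥ 0 for all a ∈ A}`. -/
def dualCone {d : ℕ} (A : Set (EuclideanSpace ℝ (Fin (d + 1)))) :
    Set (EuclideanSpace ℝ (Fin (d + 1))) :=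
  {b | ∀ a ∈ A, 0 ≤ ⟪a, b⟫}

/-- The set `u − A = {u − a : a ∈ A}`. -/
def uSub {d : ℕ} (A : Set (EuclideanSpace ℝ (Fin (d + 1)))) :
    Set (EuclideanSpace ℝ (Fin (d + 1))) :=
  {y | ∃ a ∈ A, y = unitEffect d - a}

/-- A state space: a nonempty, compact, convex subset of the hyperplane `⟨u, ω⟩ = 1`. -/
def IsStateSpace {d : ℕ} (S : Set (EuclideanSpace ℝ (Fin (d + 1)))) : Prop :=
  S.Nonempty ∧ IsCompact S ∧ Convex ℝ S ∧ ∀ ω ∈ S, ⟪unitEffect d, ω⟫ = 1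

/-- An effect space: compact, convex, spanning, containing `0` and `u`, and closed
under `e ↦ u − e`. -/
def IsEffectSpace {d : ℕ} (E : Set (EuclideanSpace ℝ (Fin (d + 1)))) : Prop :=
  IsCompact E ∧ Convex ℝ E ∧ Submodule.span ℝ E = ⊤ ∧
    (0 : EuclideanSpace ℝ (Fin (d + 1))) ∈ E ∧ unitEffect d ∈ E ∧
    ∀ e ∈ E, unitEffect d - e ∈ E

/-- `E(S) = {e : 0 ≤ ⟨e, ω⟩ ≤ 1 for all ω ∈ S}`, the unrestricted effect space. -/
def Emap {d : ℕ} (S : Set (EuclideanSpace ℝ (Fin (d + 1)))) :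
    Set (EuclideanSpace ℝ (Fin (d + 1))) :=
  {e | ∀ ω ∈ S, 0 ≤ ⟪e, ω⟫ ∧ ⟪e, ω⟫ ≤ 1}

/-- `W(𝓔) = {ω : ⟨u, ω⟩ = 1 and ⟨e, ω⟩ ≥ 0 for all e ∈ 𝓔}`. -/
def Wmap {d : ℕ} (E : Set (EuclideanSpace ℝ (Fin (d + 1)))) :
    Set (EuclideanSpace ℝ (Fin (d + 1))) :=
  {ω | ⟪unitEffect d, ω⟫ = 1 ∧ ∀ e ∈ E, 0 ≤ ⟪e, ω⟫}

/-- An observable of `𝓔`: a finite tuple of effects summing to `u`, all of whose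
subset sums lie in `𝓔`. -/
def IsObservable {d : ℕ} (E : Set (EuclideanSpace ℝ (Fin (d + 1)))) {n : ℕ}
    (e : Fin n → EuclideanSpace ℝ (Fin (d + 1))) : Prop :=
  (∀ j, e j ∈ E) ∧ (∑ j, e j = unitEffect d) ∧
    ∀ J : Finset (Fin n), (∑ j ∈ J, e j) ∈ E

/-- A frame function on `𝓔`: (V1) takes values in `[0,1]` on `𝓔`, (V2) sums to `1`
on every observable of `𝓔`. -/
def IsFrameFunction {d : ℕ} (E : Set (EuclideanSpace ℝ (Fin (d + 1))))
    (v : EuclideanSpace ℝ (Fin (d + 1)) → ℝ) : Prop :=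
  (∀ e ∈ E, 0 ≤ v e ∧ v e ≤ 1) ∧
    ∀ (n : ℕ) (e : Fin n → EuclideanSpace ℝ (Fin (d + 1))),
      IsObservable E e → ∑ j, v (e j) = 1

/-- A GPT system: a state space and an effect space with `𝓔 ⊆ E(𝒮)`. -/
def IsGPTSystem {d : ℕ} (S E : Set (EuclideanSpace ℝ (Fin (d + 1)))) : Prop :=
  IsStateSpace S ∧ IsEffectSpace E ∧ E ⊆ Emap S

/-- Noisy unrestricted: every `e ∈ E(𝒮)` has a rescaling `p • e ∈ 𝓔`, `p ∈ (0,1]`. -/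
def IsNU {d : ℕ} (S E : Set (EuclideanSpace ℝ (Fin (d + 1)))) : Prop :=
  ∀ e ∈ Emap S, ∃ p : ℝ, 0 < p ∧ p ≤ 1 ∧ p • e ∈ E

/-- Almost noisy unrestricted: every `e ∈ E(𝒮)` is approximated by some `e' ∈ E(𝒮)`
with a rescaling `p • e' ∈ 𝓔`. -/
def IsANU {d : ℕ} (S E : Set (EuclideanSpace ℝ (Fin (d + 1)))) : Prop :=
  ∀ e ∈ Emap S, ∀ ε : ℝ, 0 < ε → ∃ e' ∈ Emap S, ∃ p : ℝ,
    0 < p ∧ p ≤ 1 ∧ ‖e - e'‖ < ε ∧ p • e' ∈ E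

lemma aux_combo_mem {d : ℕ} {E : Set (EuclideanSpace ℝ (Fin (d + 1)))}
    (hc : Convex ℝ E) (h0 : (0 : EuclideanSpace ℝ (Fin (d + 1))) ∈ E)
    {ι : Type*} (s : Finset ι) (c : ι → ℝ) (e : ι → EuclideanSpace ℝ (Fin (d + 1)))
    (hcn : ∀ i ∈ s, 0 ≤ c i) (hcs : ∑ i ∈ s, c i ≤ 1) (he : ∀ i ∈ s, e i ∈ E) :
    ∑ i ∈ s, c i • e i ∈ E := by
  rcases (Finset.sum_nonneg hcn).eq_or_lt with h | h
  · have h1 := (Finset.sum_eq_zero_iff_of_nonneg hcn).1 h.symm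
    rw [Finset.sum_eq_zero (fun i hi => by rw [h1 i hi, zero_smul])]
    exact h0
  · have h1 := hc.centerMass_mem hcn h he
    have h2 := hc.smul_mem_of_zero_mem h0 h1 ⟨h.le, hcs⟩
    rwa [Finset.centerMass, smul_smul, mul_inv_cancel₀ h.ne', one_smul] at h2

lemma aux_obs {d : ℕ} {E : Set (EuclideanSpace ℝ (Fin (d + 1)))} (hE : IsEffectSpace E)
    {v : EuclideanSpace ℝ (Fin (d + 1)) → ℝ} (hv : IsFrameFunction E v)
    (a b : EuclideanSpace ℝ (Fin (d + 1))) (ha : a ∈ E) (hb : b ∈ E) (hab : a + b ∈ E) :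
    v a + v b + v (unitEffect d - (a + b)) = 1 := by
  obtain ⟨-, hc, -, h0, hu, hs⟩ := hE
  have h := hv.2 3 ![a, b, unitEffect d - (a + b)] ⟨by
      intro j; fin_cases j
      · exact ha
      · exact hb
      · exact hs _ hab, by
      simp [Fin.sum_univ_three], fun J => by
      have e1 : a + (unitEffect d - (a + b)) = unitEffect d - b := by abel
      have e2 : b + (unitEffect d - (a + b)) = unitEffect d - a := by abel
      have e4 : a + b + (unitEffect d - (a + b)) = unitEffect d := by abel
      have hJ : ∑ j ∈ J, (![a, b, unitEffect d - (a + b)] : Fin 3 → _) j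
          = ∑ j, if j ∈ J then (![a, b, unitEffect d - (a + b)] : Fin 3 → _) j else 0 := by
        simp
      rw [hJ, Fin.sum_univ_three]
      have ha' := hs _ ha
      have hb' := hs _ hb
      have hab' := hs _ hab
      by_cases c0 : (0 : Fin 3) ∈ J <;> by_cases c1 : (1 : Fin 3) ∈ J <;>
        by_cases c2 : (2 : Fin 3) ∈ J <;>
        simp only [c0, c1, c2, if_true, if_false, Matrix.cons_val, add_zero, zero_add, e1, e2, e4] <;>
        assumption⟩
  simpa [Fin.sum_univ_three] using h

lemma aux_v_zero {d : ℕ} {E : Set (EuclideanSpace ℝ (Fin (d + 1)))} (hE : IsEffectSpace E)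
    {v : EuclideanSpace ℝ (Fin (d + 1)) → ℝ} (hv : IsFrameFunction E v) : v 0 = 0 := by
  have h0 : (0 : EuclideanSpace ℝ (Fin (d + 1))) ∈ E := hE.2.2.2.1
  have hu : unitEffect d ∈ E := hE.2.2.2.2.1
  have h1 := aux_obs hE hv 0 0 h0 h0 (by simpa using h0)
  have h2 := aux_obs hE hv (unitEffect d) 0 hu h0 (by simpa using hu)
  have h3 := hv.2 4 ![unitEffect d, 0, 0, 0] ⟨by
    intro j; fin_cases j <;> assumption, by simp [Fin.sum_univ_four], fun J => by
    have hJ : ∑ j ∈ J, (![unitEffect d, 0, 0, 0] : Fin 4 → _) j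
          = ∑ j, if j ∈ J then (![unitEffect d, 0, 0, 0] : Fin 4 → _) j else 0 := by
        simp
    rw [hJ, Fin.sum_univ_four]
    by_cases c0 : (0 : Fin 4) ∈ J <;> simp [c0, h0, hu]⟩
  simp [Fin.sum_univ_four] at h1 h2 h3
  linarith

lemma aux_v_unit {d : ℕ} {E : Set (EuclideanSpace ℝ (Fin (d + 1)))} (hE : IsEffectSpace E)
    {v : EuclideanSpace ℝ (Fin (d + 1)) → ℝ} (hv : IsFrameFunction E v) :
    v (unitEffect d) = 1 := by
  have h0 : (0 : EuclideanSpace ℝ (Fin (d + 1))) ∈ E := hE.2.2.2.1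
  have h1 := aux_obs hE hv 0 0 h0 h0 (by simpa using h0)
  have h2 := aux_v_zero hE hv
  simp [h2] at h1
  exact h1

lemma aux_v_add {d : ℕ} {E : Set (EuclideanSpace ℝ (Fin (d + 1)))} (hE : IsEffectSpace E)
    {v : EuclideanSpace ℝ (Fin (d + 1)) → ℝ} (hv : IsFrameFunction E v)
    (a b : EuclideanSpace ℝ (Fin (d + 1))) (ha : a ∈ E) (hb : b ∈ E) (hab : a + b ∈ E) :
    v (a + b) = v a + v b := by
  have h0 : (0 : EuclideanSpace ℝ (Fin (d + 1))) ∈ E := hE.2.2.2.1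
  have h1 := aux_obs hE hv a b ha hb hab
  have h2 := aux_obs hE hv (a + b) 0 hab h0 (by simpa using hab)
  have h3 := aux_v_zero hE hv
  rw [add_zero, h3] at h2
  linarith

lemma aux_v_smul {d : ℕ} {E : Set (EuclideanSpace ℝ (Fin (d + 1)))} (hE : IsEffectSpace E)
    {v : EuclideanSpace ℝ (Fin (d + 1)) → ℝ} (hv : IsFrameFunction E v)
    (a : EuclideanSpace ℝ (Fin (d + 1))) (ha : a ∈ E) (t : ℝ) (ht0 : 0 ≤ t) (ht1 : t ≤ 1) :
    v (t • a) = t * v a := by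
  have h0 : (0 : EuclideanSpace ℝ (Fin (d + 1))) ∈ E := hE.2.2.2.1
  have hm : ∀ s : ℝ, 0 ≤ s → s ≤ 1 → s • a ∈ E := fun s h1 h2 =>
    hE.2.1.smul_mem_of_zero_mem h0 ha ⟨h1, h2⟩
  have hadd : ∀ s r : ℝ, 0 ≤ s → 0 ≤ r → s + r ≤ 1 → v ((s + r) • a) = v (s • a) + v (r • a) := by
    intro s r hs hr hsr
    rw [add_smul]
    apply aux_v_add hE hv _ _ (hm _ hs (by linarith)) (hm _ hr (by linarith))
    rw [← add_smul]
    exact hm _ (by linarith) hsr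
  have hmono : ∀ s r : ℝ, 0 ≤ s → s ≤ r → r ≤ 1 → v (s • a) ≤ v (r • a) := by
    intro s r hs hr hr1
    have := hadd s (r - s) hs (by linarith) (by linarith)
    rw [add_sub_cancel] at this
    have h2 := (hv.1 _ (hm (r - s) (by linarith) (by linarith))).1
    linarith
  have hnat : ∀ (k : ℕ) (s : ℝ), 0 ≤ s → k * s ≤ 1 → v ((k * s) • a) = k * v (s • a) := by
    intro k s hs
    induction k with
    | zero => intro _; simp [aux_v_zero hE hv]
    | succ k ih =>
      intro hk
      push_cast at hk ⊢
      have e : ((k : ℝ) + 1) * s = k * s + s := by ring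
      rw [e] at hk ⊢
      rw [hadd _ _ (by positivity) hs hk, ih (by linarith)]
      ring
  have hva := hv.1 _ ha
  -- |v(ta) - t v a| ≤ 1/n
  have hbd : ∀ n : ℕ, |v (t • a) - t * v a| ≤ 1 / ((n : ℝ) + 1) := by
    intro n
    have hn : (0 : ℝ) < (n : ℝ) + 1 := by positivity
    have hq : ∀ k : ℕ, k ≤ n + 1 → v (((k : ℝ) * (1 / ((n : ℝ) + 1))) • a)
        = k * (1 / ((n : ℝ) + 1)) * v a := by
      intro k hk
      have hk' : (k : ℝ) ≤ n + 1 := by exact_mod_cast hk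
      have h1 := hnat (n + 1) (1 / ((n : ℝ) + 1)) (by positivity)
        (by push_cast; rw [mul_one_div_cancel hn.ne'])
      push_cast at h1
      rw [mul_one_div_cancel hn.ne', one_smul] at h1
      rw [hnat k _ (by positivity) (by rw [mul_one_div]; exact (div_le_one hn).2 hk'), h1]
      field_simp
    set k := ⌊t * ((n : ℝ) + 1)⌋₊ with hkdef
    have hk1 : (k : ℝ) ≤ t * (n + 1) := Nat.floor_le (by positivity)
    have hk2 : t * ((n : ℝ) + 1) < k + 1 := Nat.lt_floor_add_one _
    have hlow : (k : ℝ) * (1 / ((n : ℝ) + 1)) ≤ t := by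
      rw [mul_one_div]; exact (div_le_iff₀ hn).2 hk1
    have hup : t ≤ ((k : ℝ) + 1) * (1 / ((n : ℝ) + 1)) := by
      rw [mul_one_div]; exact (le_div_iff₀ hn).2 hk2.le
    have hkn : k ≤ n + 1 := by
      have : (k : ℝ) ≤ n + 1 := by nlinarith
      exact_mod_cast this
    have hL := hmono _ _ (by positivity) hlow ht1
    rw [hq k hkn] at hL
    have hd0 : (0 : ℝ) < 1 / ((n : ℝ) + 1) := by positivity
    have hU : v (t • a) ≤ ((k : ℝ) + 1) * (1 / ((n : ℝ) + 1)) * v a := by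
      rcases hkn.lt_or_eq with h | h
      · have h2 := hq (k + 1) h
        push_cast at h2
        rw [← h2]
        refine hmono _ _ ht0 hup ?_
        rw [mul_one_div]; exact (div_le_one hn).2 (by exact_mod_cast h)
      · have h3 := hmono t 1 ht0 ht1 le_rfl
        rw [one_smul] at h3
        have h4 : (1 : ℝ) ≤ ((k : ℝ) + 1) * (1 / ((n : ℝ) + 1)) := by
          rw [mul_one_div, le_div_iff₀ hn, h]; push_cast; linarith
        nlinarith [hva.1]
    set δ := 1 / ((n : ℝ) + 1)
    rw [abs_le]
    constructor <;> nlinarith [hva.1, hva.2, mul_le_mul_of_nonneg_right hlow hva.1,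
      mul_le_mul_of_nonneg_right hup hva.1]
  by_contra hne
  have hpos : 0 < |v (t • a) - t * v a| := abs_pos.2 (sub_ne_zero.2 hne)
  obtain ⟨n, hn⟩ := exists_nat_one_div_lt hpos
  linarith [hbd n]

lemma aux_v_combo {d : ℕ} {E : Set (EuclideanSpace ℝ (Fin (d + 1)))} (hE : IsEffectSpace E)
    {v : EuclideanSpace ℝ (Fin (d + 1)) → ℝ} (hv : IsFrameFunction E v)
    {ι : Type*} (s : Finset ι) (c : ι → ℝ) (e : ι → EuclideanSpace ℝ (Fin (d + 1)))
    (hcn : ∀ i, 0 ≤ c i) (hcs : ∑ i ∈ s, c i ≤ 1) (he : ∀ i, e i ∈ E) :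
    v (∑ i ∈ s, c i • e i) = ∑ i ∈ s, c i * v (e i) := by
  classical
  have h0 : (0 : EuclideanSpace ℝ (Fin (d + 1))) ∈ E := hE.2.2.2.1
  induction s using Finset.induction_on with
  | empty => simpa using aux_v_zero hE hv
  | insert i s hi ih =>
    have hm := aux_combo_mem hE.2.1 h0 _ c e (fun i _ => hcn i) hcs (fun i _ => he i)
    rw [Finset.sum_insert hi] at hm hcs ⊢
    have hs0 : 0 ≤ ∑ i ∈ s, c i := Finset.sum_nonneg (fun i _ => hcn i)
    have hs1 : ∑ i ∈ s, c i ≤ 1 := by linarith [hcn i]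
    have hi1 : c i ≤ 1 := by linarith
    rw [Finset.sum_insert hi, ← ih hs1, ← aux_v_smul hE hv _ (he i) _ (hcn i) hi1]
    exact aux_v_add hE hv _ _ (hE.2.1.smul_mem_of_zero_mem h0 (he i) ⟨hcn i, hi1⟩)
      (aux_combo_mem hE.2.1 h0 _ c e (fun i _ => hcn i) hs1 (fun i _ => he i)) hm

lemma aux_v_ker {d : ℕ} {E : Set (EuclideanSpace ℝ (Fin (d + 1)))} (hE : IsEffectSpace E)
    {v : EuclideanSpace ℝ (Fin (d + 1)) → ℝ} (hv : IsFrameFunction E v)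
    {ι : Type*} (s : Finset ι) (c : ι → ℝ) (e : ι → EuclideanSpace ℝ (Fin (d + 1)))
    (he : ∀ i, e i ∈ E) (h : ∑ i ∈ s, c i • e i = 0) :
    ∑ i ∈ s, c i * v (e i) = 0 := by
  set M : ℝ := ∑ i ∈ s, |c i| + 1 with hM
  have hMpos : 0 < M := by
    have : 0 ≤ ∑ i ∈ s, |c i| := Finset.sum_nonneg (fun i _ => abs_nonneg _)
    linarith
  have hsum : ∀ f : ι → ℝ, (∀ i, f i ≤ |c i|) → ∑ i ∈ s, f i / M ≤ 1 := by
    intro f hf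
    rw [← Finset.sum_div, div_le_one hMpos]
    have := Finset.sum_le_sum (fun i (_ : i ∈ s) => hf i)
    linarith
  have hp := aux_v_combo hE hv s (fun i => max (c i) 0 / M) e (fun i => by positivity)
    (hsum _ (fun i => max_le (le_abs_self _) (abs_nonneg _))) he
  have hn := aux_v_combo hE hv s (fun i => max (-c i) 0 / M) e (fun i => by positivity)
    (hsum _ (fun i => max_le (neg_le_abs _) (abs_nonneg _))) he
  have hmm : ∀ i, max (c i) 0 / M = max (-c i) 0 / M + c i / M := by
    intro i
    rw [← add_div]
    congr 1
    rcases le_total 0 (c i) with h | h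
    · rw [max_eq_left h, max_eq_right (by linarith)]; ring
    · rw [max_eq_right h, max_eq_left (by linarith)]; ring
  have heq : ∑ i ∈ s, (max (c i) 0 / M) • e i = ∑ i ∈ s, (max (-c i) 0 / M) • e i := by
    simp_rw [hmm, add_smul, Finset.sum_add_distrib]
    have : ∑ i ∈ s, (c i / M) • e i = 0 := by
      have h2 : ∑ i ∈ s, (c i / M) • e i = M⁻¹ • ∑ i ∈ s, c i • e i := by
        rw [Finset.smul_sum]
        refine Finset.sum_congr rfl fun i _ => ?_
        rw [smul_smul]; congr 1; ring
      rw [h2, h, smul_zero]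
    rw [this, add_zero]
  rw [heq, hn] at hp
  simp_rw [hmm, add_mul, Finset.sum_add_distrib] at hp
  have h3 : ∑ i ∈ s, c i / M * v (e i) = (∑ i ∈ s, c i * v (e i)) / M := by
    rw [Finset.sum_div]
    exact Finset.sum_congr rfl fun i _ => by ring
  have h4 : (∑ i ∈ s, c i * v (e i)) / M = 0 := by linarith
  exact (div_eq_zero_iff.1 h4).resolve_right hMpos.ne'

lemma aux_v_rep {d : ℕ} {E : Set (EuclideanSpace ℝ (Fin (d + 1)))} (hE : IsEffectSpace E)
    {v : EuclideanSpace ℝ (Fin (d + 1)) → ℝ} (hv : IsFrameFunction E v) :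
    ∃ ω : EuclideanSpace ℝ (Fin (d + 1)), ∀ e ∈ E, v e = ⟪e, ω⟫ := by
  let T : (E →₀ ℝ) →ₗ[ℝ] EuclideanSpace ℝ (Fin (d + 1)) :=
    Finsupp.linearCombination ℝ (Subtype.val : E → _)
  let L : (E →₀ ℝ) →ₗ[ℝ] ℝ := Finsupp.linearCombination ℝ (fun e : E => v e)
  have hT : Function.Surjective T := by
    rw [← LinearMap.range_eq_top, Finsupp.range_linearCombination, Subtype.range_coe]
    exact hE.2.2.1
  obtain ⟨g, hg⟩ := T.exists_rightInverse_of_surjective (LinearMap.range_eq_top.2 hT)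
  have hker : ∀ c, T c = 0 → L c = 0 := by
    intro c hc
    simp only [T, L, Finsupp.linearCombination_apply, Finsupp.sum, smul_eq_mul] at hc ⊢
    exact aux_v_ker hE hv c.support c (fun e => (e : EuclideanSpace ℝ (Fin (d + 1))))
      (fun i => i.2) hc
  let φ : EuclideanSpace ℝ (Fin (d + 1)) →ₗ[ℝ] ℝ := L ∘ₗ g
  let ω := (InnerProductSpace.toDual ℝ (EuclideanSpace ℝ (Fin (d + 1)))).symm
    (LinearMap.toContinuousLinearMap φ)
  refine ⟨ω, fun e he => ?_⟩
  have h1 : ⟪e, ω⟫ = φ e := by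
    rw [real_inner_comm]
    simp [ω, InnerProductSpace.toDual_symm_apply]
  rw [h1]
  have h2 : L (g e - Finsupp.single ⟨e, he⟩ 1) = 0 := by
    apply hker
    have : T (g e) = e := LinearMap.congr_fun hg e
    rw [map_sub, this]
    simp [T]
  rw [map_sub, sub_eq_zero] at h2
  change v e = L (g e)
  rw [h2]
  simp [L]

lemma aux_cone_nonneg {d : ℕ} {E : Set (EuclideanSpace ℝ (Fin (d + 1)))}
    {ω : EuclideanSpace ℝ (Fin (d + 1))} (h : ∀ e ∈ E, 0 ≤ ⟪e, ω⟫) :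
    ∀ c ∈ closure (posCone E), 0 ≤ ⟪c, ω⟫ := by
  have hcl : IsClosed {c : EuclideanSpace ℝ (Fin (d + 1)) | 0 ≤ ⟪c, ω⟫} :=
    isClosed_le continuous_const (by fun_prop)
  refine fun c hc => closure_minimal ?_ hcl hc
  rintro _ ⟨x, hx, a, ha, rfl⟩
  change 0 ≤ ⟪x • a, ω⟫
  rw [real_inner_smul_left]
  exact mul_nonneg hx (h a ha)

lemma aux_cone_convex {d : ℕ} {E : Set (EuclideanSpace ℝ (Fin (d + 1)))} (hc : Convex ℝ E) :
    Convex ℝ (posCone E) := by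
  rintro _ ⟨x, hx, a, ha, rfl⟩ _ ⟨y, hy, b, hb, rfl⟩ p q hp hq hpq
  have hx' := mul_nonneg hp hx
  have hy' := mul_nonneg hq hy
  rw [smul_smul, smul_smul]
  rcases (add_nonneg hx' hy').eq_or_lt with h | h
  · have h1 : p * x = 0 := by linarith
    have h2 : q * y = 0 := by linarith
    exact ⟨0, le_rfl, a, ha, by simp [h1, h2]⟩
  · refine ⟨p * x + q * y, h.le, (p * x / (p * x + q * y)) • a + (q * y / (p * x + q * y)) • b,
      hc ha hb (by positivity) (by positivity) (by rw [← add_div, div_self h.ne']), ?_⟩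
    rw [smul_add, smul_smul, smul_smul, mul_div_cancel₀ _ h.ne', mul_div_cancel₀ _ h.ne']

lemma aux_orth {d : ℕ} {E : Set (EuclideanSpace ℝ (Fin (d + 1)))}
    (hsp : Submodule.span ℝ E = ⊤) {ω : EuclideanSpace ℝ (Fin (d + 1))}
    (h : ∀ e ∈ E, ⟪e, ω⟫ = 0) : ω = 0 := by
  have : ∀ x ∈ Submodule.span ℝ E, ⟪x, ω⟫ = 0 := by
    intro x hx
    induction hx using Submodule.span_induction with
    | mem x hx => exact h x hx
    | zero => simp
    | add x y _ _ hx hy => rw [inner_add_left, hx, hy, add_zero]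
    | smul a x _ hx => rw [real_inner_smul_left, hx, mul_zero]
  exact inner_self_eq_zero.1 (this ω (by rw [hsp]; trivial))

lemma aux_inner_frame {d : ℕ} {E : Set (EuclideanSpace ℝ (Fin (d + 1)))} (hE : IsEffectSpace E)
    {ω : EuclideanSpace ℝ (Fin (d + 1))} (h1 : ⟪unitEffect d, ω⟫ = 1)
    (h : ∀ e ∈ E, 0 ≤ ⟪e, ω⟫) : IsFrameFunction E (fun e => ⟪e, ω⟫) := by
  refine ⟨fun e he => ⟨h e he, ?_⟩, fun n e he => ?_⟩
  · have := h _ (hE.2.2.2.2.2 e he)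
    rw [inner_sub_left, h1] at this
    linarith
  · change ∑ j, ⟪e j, ω⟫ = 1
    rw [← sum_inner, he.2.1, h1]

/-- A GPT system admits a Gleason-type theorem iff it is almost
noisy unrestricted, i.e. iff `cl(𝓔⁺) ∩ (u − cl(𝓔⁺)) = E(𝒮)`. -/
theorem gleason_type_iff_almost_noisy_unrestricted {d : ℕ} (hd : 1 ≤ d)
    (S E : Set (EuclideanSpace ℝ (Fin (d + 1))))
    (hS : IsStateSpace S) (hE : IsEffectSpace E) (hSE : E ⊆ Emap S) :
    (∀ v : EuclideanSpace ℝ (Fin (d + 1)) → ℝ, IsFrameFunction E v →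
      ∃ ω ∈ S, ∀ e ∈ E, v e = ⟪e, ω⟫) ↔
    closure (posCone E) ∩ uSub (closure (posCone E)) = Emap S := by
  obtain ⟨hSne, hScomp, hSconv, hSu⟩ := hS
  obtain ⟨hEcomp, hEconv, hEspan, hE0, hEu, hEsub⟩ := id hE
  constructor
  · intro hG
    have key : Emap S ⊆ closure (posCone E) := by
      intro e he
      by_contra hne
      obtain ⟨f, r, hr1, hr2⟩ := geometric_hahn_banach_point_closed
        (aux_cone_convex hEconv).closure isClosed_closure hne
      have hr0 : r < 0 := by
        have := hr2 0 (subset_closure ⟨0, le_rfl, 0, hE0, by simp⟩)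
        simpa using this
      let ω := (InnerProductSpace.toDual ℝ (EuclideanSpace ℝ (Fin (d + 1)))).symm f
      have hω : ∀ x, ⟪x, ω⟫ = f x := by
        intro x
        rw [real_inner_comm]
        simp [ω, InnerProductSpace.toDual_symm_apply]
      have hpos : ∀ a ∈ E, 0 ≤ ⟪a, ω⟫ := by
        intro a ha
        rw [hω]
        by_contra hlt
        push Not at hlt
        have := hr2 ((r / f a) • a)
          (subset_closure ⟨r / f a, (div_pos_of_neg_of_neg hr0 hlt).le, a, ha, rfl⟩)
        rw [map_smul, smul_eq_mul, div_mul_cancel₀ _ hlt.ne] at this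
        exact lt_irrefl _ this
      have hneg : ⟪e, ω⟫ < 0 := by rw [hω]; linarith
      rcases (hpos _ hEu).eq_or_lt with h | h
      · have : ω = 0 := aux_orth hEspan fun a ha => by
          have h1 := hpos _ (hEsub a ha)
          rw [inner_sub_left] at h1
          linarith [hpos a ha]
        rw [this, inner_zero_right] at hneg
        exact lt_irrefl _ hneg
      · have hc : 0 < (⟪unitEffect d, ω⟫)⁻¹ := inv_pos.2 h
        obtain ⟨s, hs, hse⟩ := hG _ (aux_inner_frame hE
          (ω := (⟪unitEffect d, ω⟫)⁻¹ • ω)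
          (by rw [real_inner_smul_right, inv_mul_cancel₀ h.ne'])
          (fun a ha => by rw [real_inner_smul_right]; exact mul_nonneg hc.le (hpos a ha)))
        have heq : (⟪unitEffect d, ω⟫)⁻¹ • ω - s = 0 := aux_orth hEspan fun a ha => by
          rw [inner_sub_right, sub_eq_zero]; exact hse a ha
        have h2 := (he s hs).1
        rw [← sub_eq_zero.1 heq, real_inner_smul_right] at h2
        nlinarith
    apply Set.Subset.antisymm
    · rintro e ⟨he, a, ha, hea⟩ ω hω
      have hp := aux_cone_nonneg (fun x hx => (hSE hx ω hω).1)
      refine ⟨hp e he, ?_⟩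
      have := hp a ha
      rw [hea, inner_sub_left, hSu ω hω]
      linarith
    · intro e he
      refine ⟨key he, unitEffect d - e, key ?_, by abel⟩
      intro ω hω
      have := he ω hω
      rw [inner_sub_left, hSu ω hω]
      constructor <;> linarith
  · intro hA v hv
    obtain ⟨ω, hω⟩ := aux_v_rep hE hv
    refine ⟨ω, ?_, hω⟩
    by_contra hne
    obtain ⟨f, r, hr1, hr2⟩ := geometric_hahn_banach_closed_point hSconv hScomp.isClosed hne
    let w := (InnerProductSpace.toDual ℝ (EuclideanSpace ℝ (Fin (d + 1)))).symm f
    have hw : ∀ x, ⟪w, x⟫ = f x := by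
      intro x
      simp [w, InnerProductSpace.toDual_symm_apply]
    let e := r • unitEffect d - w
    have hcont : Continuous fun s : EuclideanSpace ℝ (Fin (d + 1)) => ⟪e, s⟫ := by fun_prop
    obtain ⟨M, hM⟩ := hScomp.bddAbove_image hcont.continuousOn
    have hMs : ∀ s ∈ S, ⟪e, s⟫ ≤ M := fun s hs => hM ⟨s, hs, rfl⟩
    have hes : ∀ s ∈ S, 0 < ⟪e, s⟫ := by
      intro s hs
      simp only [e, inner_sub_left, real_inner_smul_left, hSu s hs, hw]
      linarith [hr1 s hs]
    have hM0 : 0 < M := by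
      obtain ⟨s, hs⟩ := hSne
      exact (hes s hs).trans_le (hMs s hs)
    have hmem : M⁻¹ • e ∈ Emap S := by
      intro s hs
      rw [real_inner_smul_left]
      refine ⟨mul_nonneg (inv_pos.2 hM0).le (hes s hs).le, ?_⟩
      rw [inv_mul_le_iff₀ hM0, mul_one]
      exact hMs s hs
    rw [← hA] at hmem
    have h1 := aux_cone_nonneg (ω := ω) (fun x hx => by rw [← hω x hx]; exact (hv.1 x hx).1)
      _ hmem.1
    have h2 : ⟪unitEffect d, ω⟫ = 1 := by rw [← hω _ hEu]; exact aux_v_unit hE hv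
    have h3 : ⟪e, ω⟫ < 0 := by
      simp only [e, inner_sub_left, real_inner_smul_left, h2, hw]
      linarith
    rw [real_inner_smul_left] at h1
    nlinarith [inv_pos.2 hM0]
end

section
/- Let 𝓔 be an effect space. Then any frame function v on 𝓔 admits an expression v(e) = ⟨e, ω⟩ for some vector ω ∈ W(𝓔) and all effects e ∈ 𝓔. -/
open scoped RealInnerProductSpace

section aux
variable {d : ℕ} {E : Set (EuclideanSpace ℝ (Fin (d + 1)))}
  {v : EuclideanSpace ℝ (Fin (d + 1)) → ℝ}

theorem aux_u (hE : IsEffectSpace E) (hv : IsFrameFunction E v) : v (unitEffect d) = 1 := by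
  obtain ⟨_, _, _, h0, hu, hc⟩ := hE
  have := hv.2 1 (fun _ => unitEffect d) ⟨fun _ => hu, by simp, fun J => by
    rcases Finset.eq_empty_or_nonempty J with rfl | h
    · simpa using h0
    · have : J = Finset.univ := by
        obtain ⟨x, hx⟩ := h
        ext y
        rw [Subsingleton.elim y x]
        exact ⟨fun _ => Finset.mem_univ _, fun _ => hx⟩
      simpa [this] using hu⟩
  simpa using this

theorem aux_compl (hE : IsEffectSpace E) (hv : IsFrameFunction E v)
    {e : EuclideanSpace ℝ (Fin (d + 1))} (he : e ∈ E) : v e + v (unitEffect d - e) = 1 := by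
  obtain ⟨_, _, _, h0, hu, hc⟩ := hE
  have := hv.2 2 ![e, unitEffect d - e] ⟨by
      intro j; fin_cases j
      · exact he
      · exact hc e he, by simp [Fin.sum_univ_two], fun J => by
    rw [← Finset.univ_inter J, ← Finset.sum_ite_mem]
    rw [Fin.sum_univ_two]
    by_cases h1 : (0 : Fin 2) ∈ J <;> by_cases h2 : (1 : Fin 2) ∈ J <;>
      simp [h1, h2, h0, hu, he, hc e he]⟩
  simpa [Fin.sum_univ_two] using this

theorem aux_add (hE : IsEffectSpace E) (hv : IsFrameFunction E v)
    {e f : EuclideanSpace ℝ (Fin (d + 1))} (he : e ∈ E) (hf : f ∈ E) (hef : e + f ∈ E) :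
    v (e + f) = v e + v f := by
  have h2 := aux_compl hE hv hef
  obtain ⟨_, _, _, h0, hu, hc⟩ := hE
  have := hv.2 3 ![e, f, unitEffect d - (e + f)] ⟨by
      intro j; fin_cases j
      · exact he
      · exact hf
      · exact hc _ hef, by simp [Fin.sum_univ_three], fun J => by
    rw [← Finset.univ_inter J, ← Finset.sum_ite_mem]
    rw [Fin.sum_univ_three]
    have e1 : e + (unitEffect d - (e + f)) = unitEffect d - f := by abel
    have e2 : f + (unitEffect d - (e + f)) = unitEffect d - e := by abel
    by_cases h1 : (0 : Fin 3) ∈ J <;> by_cases h2 : (1 : Fin 3) ∈ J <;>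
      by_cases h3 : (2 : Fin 3) ∈ J <;>
      simp only [h1, h2, h3, if_true, if_false, Matrix.cons_val_zero, Matrix.cons_val_one,
        Matrix.cons_val, add_zero, zero_add, e1, e2, add_sub_cancel] <;>
      first | assumption | exact hc _ ‹_› ⟩
  simp [Fin.sum_univ_three] at this
  linarith

theorem aux_smul_mem (hE : IsEffectSpace E) {e : EuclideanSpace ℝ (Fin (d + 1))} (he : e ∈ E)
    {t : ℝ} (h0 : 0 ≤ t) (h1 : t ≤ 1) : t • e ∈ E :=
  hE.2.1.smul_mem_of_zero_mem hE.2.2.2.1 he ⟨h0, h1⟩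

theorem aux_nat (hE : IsEffectSpace E) (hv : IsFrameFunction E v)
    {e : EuclideanSpace ℝ (Fin (d + 1))} (he : e ∈ E) {s : ℝ} (hs : 0 ≤ s) (k : ℕ)
    (hk : k * s ≤ 1) : v ((k * s : ℝ) • e) = k * v (s • e) := by
  induction k with
  | zero =>
    have h0 := hE.2.2.2.1
    have := aux_add hE hv h0 h0 (by simpa using h0)
    simp at this
    simp [this]
  | succ k ih =>
    push_cast at hk ⊢
    have hks : 0 ≤ k * s := by positivity
    have e1 : ((k + 1 : ℝ) * s) • e = (k * s : ℝ) • e + s • e := by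
      rw [← add_smul]; ring_nf
    have := aux_add hE hv (e := (k * s : ℝ) • e) (f := s • e)
      (aux_smul_mem hE he hks (by linarith)) (aux_smul_mem hE he hs (by linarith))
      (by rw [← e1]; exact aux_smul_mem hE he (by positivity) hk)
    rw [e1, this, ih (by linarith)]
    ring

theorem aux_mono (hE : IsEffectSpace E) (hv : IsFrameFunction E v)
    {e : EuclideanSpace ℝ (Fin (d + 1))} (he : e ∈ E) {s t : ℝ} (hs : 0 ≤ s) (hst : s ≤ t)
    (ht : t ≤ 1) : v (s • e) ≤ v (t • e) := by
  have h2 := aux_smul_mem hE he (sub_nonneg.2 hst) (by linarith)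
  have e1 : s • e + (t - s) • e = t • e := by rw [← add_smul]; ring_nf
  have := aux_add hE hv (aux_smul_mem hE he hs (by linarith)) h2
    (by rw [e1]; exact aux_smul_mem hE he (by linarith) ht)
  rw [e1] at this
  linarith [(hv.1 _ h2).1]

theorem aux_smul (hE : IsEffectSpace E) (hv : IsFrameFunction E v)
    {e : EuclideanSpace ℝ (Fin (d + 1))} (he : e ∈ E) {t : ℝ} (h0 : 0 ≤ t) (h1 : t ≤ 1) :
    v (t • e) = t * v e := by
  -- key estimate
  have key : ∀ n : ℕ, 0 < n → |v (t • e) - t * v e| * n ≤ 1 := by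
    intro n hn
    have hn' : (0 : ℝ) < n := by exact_mod_cast hn
    have hq : ∀ k : ℕ, k ≤ n → v ((k / n : ℝ) • e) = k / n * v e := by
      intro k hk
      have hk' : (k : ℝ) ≤ n := by exact_mod_cast hk
      have a := aux_nat hE hv he (s := 1 / n) (by positivity) k
        (by rw [mul_one_div, div_le_one hn']; exact hk')
      have b := aux_nat hE hv he (s := 1 / n) (by positivity) n
        (by rw [mul_one_div, div_self hn'.ne'])
      rw [mul_one_div] at a b
      rw [div_self hn'.ne', one_smul] at b
      rw [a, b]; field_simp
    obtain ⟨hve0, hve1⟩ := hv.1 e he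
    rcases h1.eq_or_lt with rfl | hlt
    · simp
    set k := ⌊t * n⌋₊ with hkdef
    have hk1 : (k : ℝ) ≤ t * n := Nat.floor_le (by positivity)
    have hk2 : t * n < k + 1 := Nat.lt_floor_add_one _
    have hkn : k < n := by
      have : (k : ℝ) < n := by nlinarith
      exact_mod_cast this
    have hkn' : (k : ℝ) + 1 ≤ n := by exact_mod_cast hkn
    have l1 : (k / n : ℝ) ≤ t := by rw [div_le_iff₀ hn']; exact hk1
    have l2 : t ≤ ((k + 1 : ℕ) / n : ℝ) := by
      rw [le_div_iff₀ hn']; push_cast; exact hk2.le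
    have m1 := aux_mono hE hv he (by positivity) l1 h1
    have m2 := aux_mono hE hv he h0 l2 (by rw [div_le_one hn']; push_cast; exact hkn')
    rw [hq _ hkn.le, div_mul_eq_mul_div, div_le_iff₀ hn'] at m1
    rw [hq _ hkn, div_mul_eq_mul_div, le_div_iff₀ hn'] at m2
    push_cast at m2
    rw [← abs_of_pos hn', ← abs_mul, abs_le]
    constructor <;> nlinarith
  by_contra hne
  have hpos : 0 < |v (t • e) - t * v e| := abs_pos.2 (sub_ne_zero.2 hne)
  obtain ⟨n, hn⟩ := exists_nat_gt (1 / |v (t • e) - t * v e|)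
  have hn0 : 0 < n := by
    have : (0 : ℝ) < n := lt_trans (by positivity) hn
    exact_mod_cast this
  rw [div_lt_iff₀ hpos] at hn
  linarith [key n hn0]

theorem aux_sum_mem (hE : IsEffectSpace E) {ι : Type*} (s : Finset ι)
    (b : ι → EuclideanSpace ℝ (Fin (d + 1))) (hb : ∀ i, b i ∈ E) (a : ι → ℝ)
    (ha : ∀ i, 0 ≤ a i) (hs : ∑ i ∈ s, a i ≤ 1) : ∑ i ∈ s, a i • b i ∈ E := by
  rcases (Finset.sum_nonneg (fun i (_ : i ∈ s) => ha i)).eq_or_lt with h | h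
  · have : ∑ i ∈ s, a i • b i = 0 := Finset.sum_eq_zero fun i hi => by
      rw [(Finset.sum_eq_zero_iff_of_nonneg (fun i _ => ha i)).1 h.symm i hi, zero_smul]
    rw [this]; exact hE.2.2.2.1
  · have := hE.2.1.centerMass_mem (t := s) (w := a) (z := b) (fun i _ => ha i) h
      (fun i _ => hb i)
    have := aux_smul_mem hE this h.le hs
    rwa [Finset.centerMass, smul_inv_smul₀ h.ne'] at this

theorem aux_sum (hE : IsEffectSpace E) (hv : IsFrameFunction E v) {ι : Type*} (s : Finset ι)
    (b : ι → EuclideanSpace ℝ (Fin (d + 1))) (hb : ∀ i, b i ∈ E) (a : ι → ℝ)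
    (ha : ∀ i, 0 ≤ a i) (hs : ∑ i ∈ s, a i ≤ 1) :
    v (∑ i ∈ s, a i • b i) = ∑ i ∈ s, a i * v (b i) := by
  classical
  induction s using Finset.induction_on with
  | empty => 
    have := aux_smul hE hv hE.2.2.2.1 (t := 0) le_rfl zero_le_one
    simpa using this
  | insert j s hj ih =>
    have hm := aux_sum_mem hE _ b hb a ha hs
    rw [Finset.sum_insert hj] at hs hm ⊢
    have hn := Finset.sum_nonneg (fun i (_ : i ∈ s) => ha i)
    have haj := ha j
    rw [aux_add hE hv (aux_smul_mem hE (hb j) haj (by linarith))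
      (aux_sum_mem hE s b hb a ha (by linarith)) hm, ih (by linarith),
      aux_smul hE hv (hb j) haj (by linarith), Finset.sum_insert hj]

end aux

/-- Any frame function on an effect space `𝓔` is represented by
some vector `ω ∈ W(𝓔)`. -/
theorem frame_function_representation {d : ℕ} (hd : 1 ≤ d)
    (E : Set (EuclideanSpace ℝ (Fin (d + 1)))) (hE : IsEffectSpace E)
    (v : EuclideanSpace ℝ (Fin (d + 1)) → ℝ) (hv : IsFrameFunction E v) :
    ∃ ω ∈ Wmap E, ∀ e ∈ E, v e = ⟪e, ω⟫ := by
  classical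
  let B := Module.Basis.ofSpan (K := ℝ) (s := E) hE.2.2.1.ge
  have hB : ∀ i, B i ∈ E := fun i => Module.Basis.ofSpan_subset hE.2.2.1.ge ⟨i, rfl⟩
  haveI := Module.Finite.finite_basis B
  haveI := Fintype.ofFinite (↑(LinearIndepOn.extend (linearIndepOn_empty ℝ id) (Set.empty_subset E)))
  let L := B.constr ℝ (fun i => v (B i))
  have hL : ∀ e ∈ E, v e = L e := by
    intro e he
    let c := fun i => B.repr e i
    have hc : ∑ i, c i • B i = e := B.sum_repr e
    let N : ℝ := 1 + ∑ i, |c i|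
    have hS : 0 ≤ ∑ i, |c i| := Finset.sum_nonneg fun i _ => abs_nonneg _
    have hN : 0 < N := by simp only [N]; linarith
    have hpm : ∀ f : _ → ℝ, (∀ i, f i ≤ |c i|) → ∑ i, f i / N ≤ 1 := by
      intro f hf
      rw [← Finset.sum_div, div_le_one hN]
      have := Finset.sum_le_sum (fun i (_ : i ∈ Finset.univ) => hf i)
      simp only [N]; linarith
    have hp := hpm (fun i => max (c i) 0) (fun i => max_le (le_abs_self _) (abs_nonneg _))
    have hm := hpm (fun i => max (-c i) 0) (fun i => max_le (neg_le_abs _) (abs_nonneg _))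
    have hp0 : ∀ i, 0 ≤ max (c i) 0 / N := fun i => div_nonneg (le_max_right _ _) hN.le
    have hm0 : ∀ i, 0 ≤ max (-c i) 0 / N := fun i => div_nonneg (le_max_right _ _) hN.le
    have hcc : ∀ i, max (c i) 0 / N = N⁻¹ * c i + max (-c i) 0 / N := by
      intro i
      have : max (c i) 0 = c i + max (-c i) 0 := by
        rcases le_total (c i) 0 with h | h
        · rw [max_eq_right h, max_eq_left (by linarith)]; ring
        · rw [max_eq_left h, max_eq_right (by linarith)]; ring
      rw [this]; field_simp
    have heq : N⁻¹ • e + ∑ i, (max (-c i) 0 / N) • B i = ∑ i, (max (c i) 0 / N) • B i := by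
      conv_lhs => rw [← hc]
      rw [Finset.smul_sum, ← Finset.sum_add_distrib]
      refine Finset.sum_congr rfl fun i _ => ?_
      rw [hcc, add_smul, mul_smul]
    have hN0 : 0 ≤ N⁻¹ := by positivity
    have hN1 : N⁻¹ ≤ 1 := inv_le_one_of_one_le₀ (by simp only [N]; linarith)
    have h1 := aux_add hE hv (aux_smul_mem hE he hN0 hN1)
      (aux_sum_mem hE Finset.univ B hB _ hm0 hm)
      (by rw [heq]; exact aux_sum_mem hE Finset.univ B hB _ hp0 hp)
    rw [heq, aux_sum hE hv _ _ hB _ hp0 hp, aux_sum hE hv _ _ hB _ hm0 hm,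
      aux_smul hE hv he hN0 hN1] at h1
    have h2 : ∑ i, max (c i) 0 / N * v (B i)
        = N⁻¹ * ∑ i, c i * v (B i) + ∑ i, max (-c i) 0 / N * v (B i) := by
      rw [Finset.mul_sum, ← Finset.sum_add_distrib]
      refine Finset.sum_congr rfl fun i _ => ?_
      rw [hcc]; ring
    have h3 : v e = ∑ i, c i * v (B i) := by
      have : N⁻¹ * v e = N⁻¹ * ∑ i, c i * v (B i) := by linarith
      exact mul_left_cancel₀ (inv_ne_zero hN.ne') this
    rw [h3]
    simp [L, c, Module.Basis.constr_apply_fintype, Module.Basis.equivFun_apply]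
  let ω := (InnerProductSpace.toDual ℝ _).symm (LinearMap.toContinuousLinearMap L)
  have hω : ∀ e, ⟪e, ω⟫ = L e := by
    intro e
    rw [real_inner_comm, InnerProductSpace.toDual_symm_apply]
    rfl
  have hu := hE.2.2.2.2.1
  refine ⟨ω, ⟨?_, ?_⟩, fun e he => by rw [hω, hL e he]⟩
  · rw [hω, ← hL _ hu, aux_u hE hv]
  · intro e he
    rw [hω, ← hL e he]
    exact (hv.1 e he).1
end

section
/- For any state space 𝒮, one has W(E(𝒮)) = 𝒮; that is, the set of normalized vectors giving nonnegative values on all effects in E(𝒮) is exactly the state space itself. -/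
open scoped RealInnerProductSpace

/-- For any state space `𝒮`, `W(E(𝒮)) = 𝒮`. -/
theorem Wmap_Emap_eq_self {d : ℕ} (hd : 1 ≤ d)
    (S : Set (EuclideanSpace ℝ (Fin (d + 1)))) (hS : IsStateSpace S) :
    Wmap (Emap S) = S := by
  obtain ⟨-, hc, hconv, hu⟩ := hS
  ext x
  constructor
  · rintro ⟨hx1, hx⟩
    by_contra hxS
    obtain ⟨f, c, hfx, hfb⟩ := geometric_hahn_banach_point_closed hconv hc.isClosed hxS
    obtain ⟨g, hg⟩ : ∃ g : EuclideanSpace ℝ (Fin (d + 1)), ∀ y, ⟪g, y⟫ = f y :=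
      ⟨(InnerProductSpace.toDual ℝ _).symm f, fun y => by simp⟩
    obtain ⟨M, hM⟩ := (hc.image f.continuous).bddAbove
    have key : ∀ y, ⟪unitEffect d, y⟫ = 1 →
        ⟪(|M - c| + 1)⁻¹ • (g - c • unitEffect d), y⟫ = (|M - c| + 1)⁻¹ * (f y - c) := by
      intro y hy
      rw [real_inner_smul_left, inner_sub_left, real_inner_smul_left, hy, hg, mul_one]
    have hpos : 0 < |M - c| + 1 := by positivity
    have h := hx ((|M - c| + 1)⁻¹ • (g - c • unitEffect d)) (by
      intro b hb
      rw [key b (hu b hb)]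
      have h1 := hfb b hb
      have h2 : f b ≤ M := hM ⟨b, hb, rfl⟩
      refine ⟨mul_nonneg (inv_nonneg.2 hpos.le) (by linarith), ?_⟩
      rw [inv_mul_le_iff₀ hpos]
      have := le_abs_self (M - c)
      linarith)
    rw [key x hx1] at h
    have := mul_neg_of_pos_of_neg (inv_pos.2 hpos) (sub_neg.2 hfx)
    linarith
  · intro hx
    exact ⟨hu x hx, fun e he => (he x hx).1⟩
end

section
/- Given a GPT system with state space 𝒮 and effect space 𝓔, the relation E(W(𝓔)) = E(𝒮) holds if and only if E(𝒮) = cl(𝓔⁺) ∩ (u − cl(𝓔⁺)). -/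
open scoped RealInnerProductSpace

theorem aux_mem_closure {d : ℕ} (E : Set (EuclideanSpace ℝ (Fin (d + 1))))
    (hE : IsEffectSpace E) (e : EuclideanSpace ℝ (Fin (d + 1)))
    (he : ∀ ω ∈ Wmap E, 0 ≤ ⟪e, ω⟫) : e ∈ closure (posCone E) := by
  obtain ⟨-, hconv, hspan, h0, hu, hcomp⟩ := hE
  by_contra hne
  have hcv : Convex ℝ (posCone E) := by
    rintro _ ⟨x, hx, a, ha, rfl⟩ _ ⟨y, hy, b, hb, rfl⟩ s t hs ht hst
    rcases (add_nonneg (mul_nonneg hs hx) (mul_nonneg ht hy)).eq_or_lt with h | h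
    · have h1 : s * x = 0 := by nlinarith [mul_nonneg hs hx, mul_nonneg ht hy]
      have h2 : t * y = 0 := by nlinarith [mul_nonneg hs hx, mul_nonneg ht hy]
      exact ⟨0, le_rfl, 0, h0, by simp [smul_smul, h1, h2]⟩
    · refine ⟨s * x + t * y, h.le, _, hconv ha hb
        (div_nonneg (mul_nonneg hs hx) h.le) (div_nonneg (mul_nonneg ht hy) h.le)
        (by rw [← add_div, div_self h.ne']), ?_⟩
      rw [smul_add, smul_smul, smul_smul, smul_smul, smul_smul,
        mul_div_cancel₀ _ h.ne', mul_div_cancel₀ _ h.ne']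
  obtain ⟨f, s, hf, hs⟩ := geometric_hahn_banach_closed_point hcv.closure isClosed_closure hne
  have hmem : ∀ x : ℝ, 0 ≤ x → ∀ a ∈ E, x * f a < s := by
    intro x hx a ha
    have := hf _ (subset_closure ⟨x, hx, a, ha, rfl⟩)
    simpa using this
  have hs0 : 0 < s := by simpa using hmem 0 le_rfl 0 h0
  have hfa : ∀ a ∈ E, f a ≤ 0 := by
    intro a ha
    by_contra hc
    push Not at hc
    have := hmem (s / f a) (div_nonneg hs0.le hc.le) a ha
    rw [div_mul_cancel₀ _ hc.ne'] at this
    exact lt_irrefl _ this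
  obtain ⟨z, hz⟩ : ∃ z, ∀ x, ⟪x, z⟫ = f x := by
    refine ⟨(InnerProductSpace.toDual ℝ _).symm f, fun x => ?_⟩
    rw [real_inner_comm, InnerProductSpace.toDual_symm_apply]
  rcases (hfa _ hu).eq_or_lt with h | h
  · have hzero : ∀ a ∈ E, f a = 0 := by
      intro a ha
      have := hfa _ (hcomp a ha)
      rw [map_sub, h] at this
      linarith [hfa a ha]
    have hle : Submodule.span ℝ E ≤ LinearMap.ker (f : EuclideanSpace ℝ (Fin (d + 1)) →ₗ[ℝ] ℝ) :=
      Submodule.span_le.2 fun a ha => by simpa using hzero a ha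
    have : f e = 0 := by
      have := hle (hspan ▸ Submodule.mem_top : e ∈ Submodule.span ℝ E)
      simpa using this
    linarith
  · have hi : (f (unitEffect d))⁻¹ < 0 := inv_lt_zero.2 h
    have := he ((f (unitEffect d))⁻¹ • z) ⟨by
      rw [inner_smul_right, hz, inv_mul_cancel₀ h.ne], fun a ha => by
      rw [inner_smul_right, hz]
      exact mul_nonneg_of_nonpos_of_nonpos hi.le (hfa a ha)⟩
    rw [inner_smul_right, hz] at this
    nlinarith

theorem aux_nonneg {d : ℕ} (E : Set (EuclideanSpace ℝ (Fin (d + 1))))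
    (e : EuclideanSpace ℝ (Fin (d + 1))) (he : e ∈ closure (posCone E)) :
    ∀ ω ∈ Wmap E, 0 ≤ ⟪e, ω⟫ := by
  intro ω hω
  have hcl : IsClosed {x : EuclideanSpace ℝ (Fin (d + 1)) | 0 ≤ ⟪x, ω⟫} :=
    isClosed_le continuous_const (by fun_prop)
  refine closure_minimal ?_ hcl he
  rintro _ ⟨x, hx, a, ha, rfl⟩
  rw [Set.mem_setOf_eq, real_inner_smul_left]
  exact mul_nonneg hx (hω.2 a ha)

theorem aux_eq {d : ℕ} (E : Set (EuclideanSpace ℝ (Fin (d + 1)))) (hE : IsEffectSpace E) :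
    Emap (Wmap E) = closure (posCone E) ∩ uSub (closure (posCone E)) := by
  ext e
  constructor
  · intro he
    refine ⟨aux_mem_closure E hE e fun ω hω => (he ω hω).1, unitEffect d - e,
      aux_mem_closure E hE _ fun ω hω => ?_, by abel⟩
    rw [inner_sub_left, hω.1]
    linarith [(he ω hω).2]
  · rintro ⟨h1, a, ha, rfl⟩ ω hω
    refine ⟨aux_nonneg E _ h1 ω hω, ?_⟩
    rw [inner_sub_left, hω.1]
    linarith [aux_nonneg E a ha ω hω]

/-- For a GPT system, `E(W(𝓔)) = E(𝒮)` iff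
`E(𝒮) = cl(𝓔⁺) ∩ (u − cl(𝓔⁺))`. -/
theorem Emap_Wmap_eq_iff {d : ℕ} (hd : 1 ≤ d)
    (S E : Set (EuclideanSpace ℝ (Fin (d + 1))))
    (hS : IsStateSpace S) (hE : IsEffectSpace E) (hSE : E ⊆ Emap S) :
    Emap (Wmap E) = Emap S ↔
      Emap S = closure (posCone E) ∩ uSub (closure (posCone E)) := by
  rw [aux_eq E hE]
  exact eq_comm
end

section
/- A GPT system (𝒮, 𝓔) is almost noisy unrestricted if and only if its state and effect spaces are related by E(𝒮) = cl(𝓔⁺) ∩ (u − cl(𝓔⁺)). -/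
open scoped RealInnerProductSpace

/-- A GPT system is almost noisy unrestricted iff
`E(𝒮) = cl(𝓔⁺) ∩ (u − cl(𝓔⁺))`. -/
theorem aNU_iff {d : ℕ} (hd : 1 ≤ d)
    (S E : Set (EuclideanSpace ℝ (Fin (d + 1))))
    (hS : IsStateSpace S) (hE : IsEffectSpace E) (hSE : E ⊆ Emap S) :
    IsANU S E ↔ Emap S = closure (posCone E) ∩ uSub (closure (posCone E)) := by
  obtain ⟨hne, hSc, -, hu⟩ := hS
  obtain ⟨hEc, hEconv, -, h0, hu1, hEsub⟩ := hE
  have hcl : ∀ y ∈ closure (posCone E), ∀ ω ∈ S, 0 ≤ ⟪y, ω⟫ := by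
    intro y hy ω hω
    have hcl' : IsClosed {y : EuclideanSpace ℝ (Fin (d + 1)) | 0 ≤ ⟪y, ω⟫} :=
      isClosed_le continuous_const (by fun_prop)
    refine closure_minimal ?_ hcl' hy
    rintro _ ⟨x, hx, a, ha, rfl⟩
    simp only [Set.mem_setOf_eq, real_inner_smul_left]
    exact mul_nonneg hx (hSE ha ω hω).1
  constructor
  · intro h
    have key : Emap S ⊆ closure (posCone E) := by
      intro e he
      rw [Metric.mem_closure_iff]
      intro ε hε
      obtain ⟨e', he', p, hp, hp1, hn, hpe⟩ := h e he ε hε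
      refine ⟨e', ⟨p⁻¹, by positivity, _, hpe, ?_⟩, by rwa [dist_eq_norm]⟩
      rw [smul_smul, inv_mul_cancel₀ hp.ne', one_smul]
    apply Set.Subset.antisymm
    · intro e he
      refine ⟨key he, unitEffect d - e, key ?_, by abel⟩
      intro ω hω
      have := he ω hω
      rw [inner_sub_left, hu ω hω]
      constructor <;> linarith
    · rintro e ⟨h1, a, ha, rfl⟩ ω hω
      refine ⟨hcl _ h1 ω hω, ?_⟩
      have := hcl _ ha ω hω
      rw [inner_sub_left, hu ω hω]
      linarith
  · intro h e he ε hε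
    have hec : e ∈ closure (posCone E) := by
      rw [h] at he
      exact he.1
    obtain ⟨M, hM0, hM⟩ := hSc.isBounded.exists_pos_norm_le
    set C : ℝ := 1 + (‖e‖ + 1) * M with hC
    have hCpos : 0 < C := by positivity
    obtain ⟨δ, hδ, hδ1, hδ2⟩ : ∃ δ : ℝ, 0 < δ ∧ δ ≤ 1 ∧ δ * C < ε := by
      refine ⟨min 1 (ε / (2 * C)), by positivity, min_le_left _ _, ?_⟩
      calc min 1 (ε / (2 * C)) * C ≤ ε / (2 * C) * C := by
            gcongr
            exact min_le_right _ _
        _ = ε / 2 := by field_simp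
        _ < ε := by linarith
    obtain ⟨f, hf, hfd⟩ := Metric.mem_closure_iff.1 hec δ hδ
    have hfS := hcl f (subset_closure hf)
    obtain ⟨x, hx, a, ha, rfl⟩ := hf
    rw [dist_eq_norm] at hfd
    set f := x • a with hfdef
    have hK : 0 < 1 + δ * M := by positivity
    have hfn : ‖f‖ ≤ ‖e‖ + 1 := by
      have : ‖f‖ ≤ ‖e‖ + ‖e - f‖ := norm_le_norm_add_norm_sub e f
      linarith
    set K : ℝ := 1 + δ * M with hKd
    have hK1 : 1 ≤ K := by rw [hKd]; nlinarith [mul_pos hδ hM0]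
    refine ⟨K⁻¹ • f, ?_, (max 1 (K⁻¹ * x))⁻¹, by positivity,
      inv_le_one_of_one_le₀ (le_max_left _ _), ?_, ?_⟩
    · intro ω hω
      rw [real_inner_smul_left]
      refine ⟨mul_nonneg (by positivity) (hfS ω hω), ?_⟩
      rw [inv_mul_le_iff₀ hK, mul_one]
      have h1 := (he ω hω).2
      have h2 : ⟪f - e, ω⟫ ≤ ‖f - e‖ * ‖ω‖ := real_inner_le_norm _ _
      rw [inner_sub_left, norm_sub_rev] at h2
      have h3 : ‖e - f‖ * ‖ω‖ ≤ δ * M := by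
        have := hM ω hω
        gcongr
      linarith
    · have e1 : e - K⁻¹ • f = (e - f) + (1 - K⁻¹) • f := by
        rw [sub_smul, one_smul]; abel
      have hKi : 0 ≤ 1 - K⁻¹ := by
        have := inv_le_one_of_one_le₀ hK1
        linarith
      have hKi2 : 1 - K⁻¹ ≤ δ * M := by
        have h5 : K * K⁻¹ = 1 := mul_inv_cancel₀ hK.ne'
        have h6 : 1 - K⁻¹ = (K - 1) * K⁻¹ := by rw [sub_mul, h5, one_mul]
        have h7 : K - 1 = δ * M := by rw [hKd]; ring
        rw [h6, h7]
        exact mul_le_of_le_one_right (by positivity) (by linarith)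
      calc ‖e - K⁻¹ • f‖ ≤ ‖e - f‖ + ‖(1 - K⁻¹) • f‖ := by
            rw [e1]; exact norm_add_le _ _
        _ = ‖e - f‖ + (1 - K⁻¹) * ‖f‖ := by
            rw [norm_smul, Real.norm_of_nonneg hKi]
        _ ≤ δ + (δ * M) * (‖e‖ + 1) := by gcongr
        _ = δ * C := by rw [hC]; ring
        _ < ε := hδ2
    · have hm : 0 < max 1 (K⁻¹ * x) := by positivity
      rw [hfdef, smul_smul, smul_smul]
      refine hEconv.smul_mem_of_zero_mem h0 ha ⟨by positivity, ?_⟩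
      rw [mul_assoc, inv_mul_le_iff₀ hm, mul_one]
      exact le_max_right _ _
end

section
/- In an almost noisy unrestricted GPT system (𝒮, 𝓔), the closure of the positive cone of the effect space equals the positive cone of the unrestricted effect space: cl(𝓔⁺) = E(𝒮)⁺, and this common cone equals the dual cone 𝒮* of the state space. -/
open scoped RealInnerProductSpace

/-- In an almost NU GPT system, `cl(𝓔⁺) = E(𝒮)⁺` and this cone
equals the dual cone `𝒮*` of the state space. -/
theorem aNU_closure_posCone_eq {d : ℕ} (hd : 1 ≤ d)
    (S E : Set (EuclideanSpace ℝ (Fin (d + 1))))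
    (hS : IsStateSpace S) (hE : IsEffectSpace E) (hSE : E ⊆ Emap S)
    (hanu : IsANU S E) :
    closure (posCone E) = posCone (Emap S) ∧ posCone (Emap S) = dualCone S := by
  have h2 : posCone (Emap S) = dualCone S := by
    apply Set.Subset.antisymm
    · rintro y ⟨x, hx, a, ha, rfl⟩ ω hω
      rw [real_inner_smul_right, real_inner_comm]
      exact mul_nonneg hx (ha ω hω).1
    · intro b hb
      obtain ⟨M, hM⟩ := hS.2.1.isBounded.exists_norm_le
      have hpos : 0 < ‖b‖ * |M| + 1 := by positivity
      refine ⟨‖b‖ * |M| + 1, hpos.le, (‖b‖ * |M| + 1)⁻¹ • b, ?_, ?_⟩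
      · intro ω hω
        have h0 := hb ω hω
        rw [real_inner_comm] at h0
        rw [real_inner_smul_left]
        refine ⟨mul_nonneg (inv_nonneg.2 hpos.le) h0, ?_⟩
        rw [inv_mul_le_iff₀ hpos]
        have h3 := real_inner_le_norm b ω
        have h4 : ‖b‖ * ‖ω‖ ≤ ‖b‖ * |M| :=
          mul_le_mul_of_nonneg_left ((hM ω hω).trans (le_abs_self M)) (norm_nonneg b)
        linarith
      · rw [smul_smul, mul_inv_cancel₀ hpos.ne', one_smul]
  have hcl : IsClosed (dualCone S) := by
    have : dualCone S = ⋂ a ∈ S, {b | 0 ≤ ⟪a, b⟫} := by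
      ext b
      simp [dualCone]
    rw [this]
    exact isClosed_biInter fun a _ =>
      isClosed_le continuous_const (continuous_const.inner continuous_id)
  refine ⟨Set.Subset.antisymm ?_ ?_, h2⟩
  · rw [h2]
    refine closure_minimal ?_ hcl
    rw [← h2]
    rintro y ⟨x, hx, a, ha, rfl⟩
    exact ⟨x, hx, a, hSE ha, rfl⟩
  · rintro y ⟨x, hx, a, ha, rfl⟩
    rw [Metric.mem_closure_iff]
    intro ε hε
    obtain ⟨e', _, p, hp, _, hn, hpe⟩ := hanu a ha (ε / (x + 1)) (by positivity)
    refine ⟨x • e', ⟨x / p, by positivity, p • e', hpe, ?_⟩, ?_⟩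
    · rw [smul_smul, div_mul_cancel₀ _ hp.ne']
    · rw [dist_eq_norm, ← smul_sub, norm_smul, Real.norm_of_nonneg hx]
      rw [lt_div_iff₀ (by positivity)] at hn
      nlinarith [norm_nonneg (a - e')]
end

section
/- If a GPT system (𝒮, 𝓔) is noisy unrestricted, then the unrestricted effect space satisfies E(𝒮) = 𝓔⁺ ∩ (u − 𝓔⁺) (the condition of being aNU with the closures of the cones removed). -/
open scoped RealInnerProductSpace

/-- A noisy unrestricted GPT system satisfies
`E(𝒮) = 𝓔⁺ ∩ (u − 𝓔⁺)`. -/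
theorem NU_Emap_eq {d : ℕ} (hd : 1 ≤ d)
    (S E : Set (EuclideanSpace ℝ (Fin (d + 1))))
    (hS : IsStateSpace S) (hE : IsEffectSpace E) (hSE : E ⊆ Emap S)
    (hnu : IsNU S E) :
    Emap S = posCone E ∩ uSub (posCone E) := by
  obtain ⟨-, -, -, hu⟩ := hS
  have key : ∀ e ∈ Emap S, e ∈ posCone E := by
    intro e he
    obtain ⟨p, hp, -, hpe⟩ := hnu e he
    exact ⟨p⁻¹, inv_nonneg.mpr hp.le, p • e, hpe, by rw [inv_smul_smul₀ hp.ne']⟩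
  have pos : ∀ y ∈ posCone E, ∀ ω ∈ S, 0 ≤ ⟪y, ω⟫ := by
    rintro y ⟨x, hx, a, ha, rfl⟩ ω hω
    rw [real_inner_smul_left]
    exact mul_nonneg hx (hSE ha ω hω).1
  ext e
  constructor
  · intro he
    refine ⟨key e he, unitEffect d - e, key _ ?_, by abel⟩
    intro ω hω
    have h := he ω hω
    rw [inner_sub_left, hu ω hω]
    constructor <;> linarith [h.1, h.2]
  · rintro ⟨h1, a, ha, rfl⟩ ω hω
    refine ⟨pos _ h1 ω hω, ?_⟩
    rw [inner_sub_left, hu ω hω]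
    linarith [pos a ha ω hω]
end

section
/- Let (𝒮, 𝓔) be an almost noisy unrestricted GPT system. Then for every n ≥ 1, every tuple e_1, …, e_n ∈ E(𝒮) with e_1 + ⋯ + e_n = u, and every ε > 0, there exist e_1', …, e_n' ∈ E(𝒮) with e_1' + ⋯ + e_n' = u and ‖e_j − e_j'‖ ≤ ε for all 1 ≤ j ≤ n, and a number p ∈ (0,1], such that the (n+1)-tuple (p•e_1', …, p•e_n', (1−p)•u) is an observable of 𝓔, i.e., its entries sum to u and every subset sum of its entries lies in 𝓔. (Any almost NU GPT system can simulate, with post-selection, an arbitrarily good approximation of any observable of the associated unrestricted system.) -/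
open scoped RealInnerProductSpace

lemma aux_half_mem {d : ℕ} {E : Set (EuclideanSpace ℝ (Fin (d + 1)))} (hE : IsEffectSpace E) :
    ∃ r : ℝ, 0 < r ∧ ∀ v : EuclideanSpace ℝ (Fin (d + 1)), ‖v‖ < r →
      (1/2 : ℝ) • unitEffect d + v ∈ E := by
  obtain ⟨-, hc, hsp, h0, hu, hsub⟩ := hE
  have hne : (interior E).Nonempty := by
    rw [hc.interior_nonempty_iff_affineSpan_eq_top]
    rw [← Set.insert_eq_of_mem h0]
    apply SetLike.coe_injective
    rw [affineSpan_insert_zero, hsp]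
    simp
  obtain ⟨x, hx⟩ := hne
  have h := hc.combo_interior_self_mem_interior hx (hsub x (interior_subset hx))
    (a := 1/2) (b := 1/2) (by norm_num) (by norm_num) (by norm_num)
  have h2 : (1/2 : ℝ) • x + (1/2 : ℝ) • (unitEffect d - x) = (1/2 : ℝ) • unitEffect d := by
    module
  rw [h2, mem_interior_iff_mem_nhds, Metric.mem_nhds_iff] at h
  obtain ⟨r, hr, hb⟩ := h
  refine ⟨r, hr, fun v hv => hb ?_⟩
  simpa [Metric.mem_ball, dist_eq_norm] using hv

/-- the cone generated by `E` -/
def auxCone {d : ℕ} (E : Set (EuclideanSpace ℝ (Fin (d + 1)))) :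
    Set (EuclideanSpace ℝ (Fin (d + 1))) := {x | ∃ s : ℝ, 0 < s ∧ s • x ∈ E}

lemma aux_shrink {d : ℕ} {E : Set (EuclideanSpace ℝ (Fin (d + 1)))} (hE : IsEffectSpace E)
    {x : EuclideanSpace ℝ (Fin (d + 1))} {s p : ℝ} (hs : 0 < s) (hx : s • x ∈ E)
    (hp : 0 ≤ p) (hps : p ≤ s) : p • x ∈ E := by
  have := hE.2.1.smul_mem_of_zero_mem hE.2.2.2.1 hx (t := p / s)
    ⟨by positivity, (div_le_one hs).2 hps⟩
  rwa [smul_smul, div_mul_cancel₀ _ hs.ne'] at this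

lemma auxCone_add {d : ℕ} {E : Set (EuclideanSpace ℝ (Fin (d + 1)))} (hE : IsEffectSpace E)
    {x y : EuclideanSpace ℝ (Fin (d + 1))} (hx : x ∈ auxCone E) (hy : y ∈ auxCone E) :
    x + y ∈ auxCone E := by
  obtain ⟨s, hs, hx⟩ := hx
  obtain ⟨t, ht, hy⟩ := hy
  have hm : 0 < min s t := lt_min hs ht
  have h1 := aux_shrink hE hs hx hm.le (min_le_left _ _)
  have h2 := aux_shrink hE ht hy hm.le (min_le_right _ _)
  refine ⟨(1/2) * min s t, by positivity, ?_⟩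
  have := hE.2.1 h1 h2 (show (0:ℝ) ≤ 1/2 by norm_num) (show (0:ℝ) ≤ 1/2 by norm_num) (by norm_num)
  rwa [← smul_add, ← smul_add, smul_smul] at this

lemma auxCone_smul {d : ℕ} {E : Set (EuclideanSpace ℝ (Fin (d + 1)))}
    {x : EuclideanSpace ℝ (Fin (d + 1))} (hx : x ∈ auxCone E) {c : ℝ} (hc : 0 < c) :
    c • x ∈ auxCone E := by
  obtain ⟨s, hs, hx⟩ := hx
  refine ⟨s / c, by positivity, ?_⟩
  rwa [smul_smul, div_mul_cancel₀ _ hc.ne']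

lemma auxCone_sum {d : ℕ} {E : Set (EuclideanSpace ℝ (Fin (d + 1)))} (hE : IsEffectSpace E)
    {n : ℕ} {f : Fin n → EuclideanSpace ℝ (Fin (d + 1))} (hf : ∀ j, f j ∈ auxCone E)
    (J : Finset (Fin n)) : ∑ j ∈ J, f j ∈ auxCone E := by
  classical
  induction J using Finset.induction_on with
  | empty => exact ⟨1, one_pos, by simpa using hE.2.2.2.1⟩
  | insert a s ha ih =>
    rw [Finset.sum_insert ha]
    exact auxCone_add hE (hf a) ih

lemma aux_observable {d : ℕ} {E : Set (EuclideanSpace ℝ (Fin (d + 1)))} (hE : IsEffectSpace E)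
    {n : ℕ} {f : Fin n → EuclideanSpace ℝ (Fin (d + 1))} (hf : ∀ j, f j ∈ auxCone E)
    (hsum : ∑ j, f j = unitEffect d) :
    ∃ p : ℝ, 0 < p ∧ p ≤ 1 ∧
      IsObservable E (Fin.snoc (fun j => p • f j) ((1 - p) • unitEffect d)) := by
  classical
  have hev : ∀ᶠ p in nhdsWithin (0 : ℝ) (Set.Ioi 0),
      ∀ J : Finset (Fin n), p • ∑ j ∈ J, f j ∈ E := by
    rw [Filter.eventually_all]
    intro J
    obtain ⟨s, hs, hx⟩ := auxCone_sum hE hf J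
    filter_upwards [Ioo_mem_nhdsGT hs] with p hp
    exact aux_shrink hE hs hx hp.1.le hp.2.le
  obtain ⟨p, hpJ, hp⟩ := (hev.and (Ioo_mem_nhdsGT one_pos)).exists
  refine ⟨p, hp.1, hp.2.le, ?_⟩
  have key : ∀ J : Finset (Fin (n + 1)), ∑ j ∈ J,
      (Fin.snoc (fun j => p • f j) ((1 - p) • unitEffect d) :
        Fin (n + 1) → EuclideanSpace ℝ (Fin (d + 1))) j ∈ E := by
    intro J
    set K : Finset (Fin n) := Finset.univ.filter (fun i => i.castSucc ∈ J) with hK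
    have e1 : ∑ j ∈ J,
      (Fin.snoc (fun j => p • f j) ((1 - p) • unitEffect d) :
        Fin (n + 1) → EuclideanSpace ℝ (Fin (d + 1))) j
        = p • ∑ j ∈ K, f j + if Fin.last n ∈ J then (1 - p) • unitEffect d else 0 := by
      rw [← Finset.univ_inter J, ← Finset.sum_ite_mem]
      rw [Fin.sum_univ_castSucc]
      simp only [Fin.snoc_castSucc, Fin.snoc_last]
      rw [hK, Finset.sum_filter, Finset.smul_sum]
      simp only [smul_ite, smul_zero, Finset.univ_inter]
    rw [e1]
    split_ifs
    · have h1 := hE.2.2.2.2.2 _ (hpJ Kᶜ)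
      have h2 := Finset.sum_add_sum_compl K f
      rw [hsum] at h2
      convert h1 using 1
      rw [← h2]
      module
    · simpa using hpJ K
  refine ⟨fun j => by simpa using key {j}, ?_, key⟩
  rw [Fin.sum_univ_castSucc]
  simp only [Fin.snoc_castSucc, Fin.snoc_last]
  rw [← Finset.smul_sum, hsum]
  module

/-- An almost NU GPT system can simulate, with post-selection, an
arbitrarily good approximation of any observable of the associated unrestricted
system. -/
theorem aNU_simulates_unrestricted_observables {d : ℕ} (hd : 1 ≤ d)
    (S E : Set (EuclideanSpace ℝ (Fin (d + 1))))
    (hS : IsStateSpace S) (hE : IsEffectSpace E) (hSE : E ⊆ Emap S)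
    (hanu : IsANU S E) :
    ∀ n : ℕ, 1 ≤ n → ∀ e : Fin n → EuclideanSpace ℝ (Fin (d + 1)),
      (∀ j, e j ∈ Emap S) → (∑ j, e j = unitEffect d) →
      ∀ ε : ℝ, 0 < ε →
        ∃ e' : Fin n → EuclideanSpace ℝ (Fin (d + 1)),
          (∀ j, e' j ∈ Emap S) ∧ (∑ j, e' j = unitEffect d) ∧
          (∀ j, ‖e j - e' j‖ ≤ ε) ∧
          ∃ p : ℝ, 0 < p ∧ p ≤ 1 ∧
            IsObservable E
              (Fin.snoc (fun j => p • e' j) ((1 - p) • unitEffect d)) := by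
  intro n hn e he hsum ε hε
  obtain ⟨r, hr, hball⟩ := aux_half_mem hE
  have hn0 : (0 : ℝ) < n := by exact_mod_cast hn
  have hu : ‖unitEffect d‖ = 1 := by simp [unitEffect]
  obtain ⟨M, hM0, hMj⟩ : ∃ M : ℝ, 0 ≤ M ∧ ∀ j, ‖e j‖ ≤ M :=
    ⟨∑ j, ‖e j‖, Finset.sum_nonneg fun _ _ => norm_nonneg _, fun j =>
      Finset.single_le_sum (f := fun j => ‖e j‖) (fun _ _ => norm_nonneg _) (Finset.mem_univ j)⟩
  obtain ⟨t, ht0, ht1, htM⟩ : ∃ t : ℝ, 0 < t ∧ t < 1 ∧ t * (M + 2) ≤ ε / 2 := by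
    refine ⟨min (1/2) (ε / (2 * (M + 2))), by positivity,
      (min_le_left _ _).trans_lt (by norm_num), ?_⟩
    calc _ ≤ ε / (2 * (M + 2)) * (M + 2) := by gcongr; exact min_le_right _ _
      _ = ε / 2 := by field_simp
  obtain ⟨δ, hδ0, hδ1, hδε, hδr⟩ : ∃ δ : ℝ, 0 < δ ∧ δ ≤ 1 ∧ δ ≤ ε / 4 ∧ n * δ ≤ r * t := by
    refine ⟨min 1 (min (ε / 4) (r * t / n)), by positivity, min_le_left _ _,
      (min_le_right _ _).trans (min_le_left _ _), ?_⟩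
    calc _ ≤ n * (r * t / n) := by
            gcongr; exact (min_le_right _ _).trans (min_le_right _ _)
      _ = r * t := by field_simp
  choose a ha q hq0 hq1 hea hqa using fun j => hanu (e j) (he j) δ hδ0
  obtain ⟨D, hD⟩ : ∃ D, D = unitEffect d - ∑ j, a j := ⟨_, rfl⟩
  have hDn : ‖D‖ ≤ n * δ := by
    rw [hD, ← hsum, ← Finset.sum_sub_distrib]
    calc _ ≤ ∑ j : Fin n, δ := norm_sum_le_of_le _ fun j _ => (hea j).le
      _ = n * δ := by simp
  have hvn : ‖((1 - t) / (2 * t)) • D‖ < r := by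
    rw [norm_smul, Real.norm_of_nonneg (div_nonneg (by linarith) (by linarith)),
      div_mul_eq_mul_div, div_lt_iff₀ (by positivity)]
    have : (1 - t) * ‖D‖ ≤ 1 * ‖D‖ := by gcongr; linarith
    have : 0 < r * t := by positivity
    linarith
  have hB := hball _ hvn
  obtain ⟨B, hBdef⟩ : ∃ B, B = (1/2 : ℝ) • unitEffect d + ((1 - t) / (2 * t)) • D := ⟨_, rfl⟩
  rw [← hBdef] at hB
  have hBe : (2 * t / n) • B = (t / n) • unitEffect d + ((1 - t) / n) • D := by
    rw [hBdef, smul_add, smul_smul, smul_smul]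
    congr 2 <;> field_simp
  set f : Fin n → EuclideanSpace ℝ (Fin (d + 1)) :=
    fun j => (1 - t) • a j + (2 * t / n) • B with hf
  have hfC : ∀ j, f j ∈ auxCone E := fun j =>
    auxCone_add hE (auxCone_smul ⟨q j, hq0 j, hqa j⟩ (by linarith))
      (auxCone_smul ⟨1, one_pos, by simpa using hB⟩ (by positivity))
  have hfsum : ∑ j, f j = unitEffect d := by
    simp only [hf]
    rw [Finset.sum_add_distrib, ← Finset.smul_sum, Finset.sum_const, hBe, Finset.card_univ,
      Fintype.card_fin, ← Nat.cast_smul_eq_nsmul ℝ, smul_add, smul_smul, smul_smul,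
      mul_div_cancel₀ _ hn0.ne', mul_div_cancel₀ _ hn0.ne', hD]
    module
  have hpos : ∀ j, ∀ ω ∈ S, 0 ≤ ⟪f j, ω⟫ := by
    intro j ω hω
    obtain ⟨s, hs, hx⟩ := hfC j
    have := (hSE hx ω hω).1
    rw [real_inner_smul_left] at this
    exact nonneg_of_mul_nonneg_right this hs
  refine ⟨f, fun j ω hω => ⟨hpos j ω hω, ?_⟩, hfsum, fun j => ?_, aux_observable hE hfC hfsum⟩
  · rw [← hS.2.2.2 ω hω, ← hfsum, sum_inner]
    exact Finset.single_le_sum (f := fun j => ⟪f j, ω⟫) (fun i _ => hpos i ω hω)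
      (Finset.mem_univ j)
  · have h1 : e j - f j = (1 - t) • (e j - a j) + t • e j - (t / n) • unitEffect d
        - ((1 - t) / n) • D := by
      simp only [hf]
      rw [hBe]
      module
    have h2 : ‖(1 - t) • (e j - a j)‖ ≤ δ := by
      rw [norm_smul, Real.norm_of_nonneg (by linarith)]
      nlinarith [hea j, norm_nonneg (e j - a j)]
    have h3 : ‖t • e j‖ ≤ t * M := by
      rw [norm_smul, Real.norm_of_nonneg ht0.le]
      gcongr
      exact hMj j
    have h4 : ‖(t / n) • unitEffect d‖ ≤ t := by
      rw [norm_smul, hu, mul_one, Real.norm_of_nonneg (by positivity)]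
      exact div_le_self ht0.le (by exact_mod_cast hn)
    have h5 : ‖((1 - t) / n) • D‖ ≤ δ := by
      rw [norm_smul, Real.norm_of_nonneg (div_nonneg (by linarith) hn0.le), div_mul_eq_mul_div,
        div_le_iff₀ hn0]
      nlinarith [norm_nonneg D]
    rw [h1]
    have h6 := norm_sub_le ((1 - t) • (e j - a j) + t • e j - (t / n) • unitEffect d)
      (((1 - t) / n) • D)
    have h7 := norm_sub_le ((1 - t) • (e j - a j) + t • e j) ((t / n) • unitEffect d)
    have h8 := norm_add_le ((1 - t) • (e j - a j)) (t • e j)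
    nlinarith
end

section
/- Let 𝓔 be an effect space and v a frame function on 𝓔. Then v is homogeneous on 𝓔: for every effect e ∈ 𝓔 and every real α ∈ [0,1], one has v(α • e) = α · v(e). -/
open scoped RealInnerProductSpace

theorem aux_additive_homog (f : ℝ → ℝ)
    (hb : ∀ t, 0 ≤ t → t ≤ 1 → 0 ≤ f t ∧ f t ≤ 1)
    (ha : ∀ s t, 0 ≤ s → 0 ≤ t → s + t ≤ 1 → f (s + t) = f s + f t)
    (t : ℝ) (h0 : 0 ≤ t) (h1 : t ≤ 1) : f t = t * f 1 := by
  have hf0 : f 0 = 0 := by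
    have := ha 0 0 le_rfl le_rfl (by norm_num)
    simp at this
    exact this
  have hn : ∀ (k : ℕ) (x : ℝ), 0 ≤ x → k * x ≤ 1 → f (k * x) = k * f x := by
    intro k
    induction k with
    | zero => intro x _ _; simp [hf0]
    | succ k ih =>
      intro x hx hk
      push_cast at hk ⊢
      have e1 : ((k : ℝ) + 1) * x = k * x + x := by ring
      rw [e1] at hk ⊢
      rw [ha (k * x) x (by positivity) hx hk, ih x hx (by linarith)]
      ring
  have key : ∀ n : ℕ, 0 < n → n * |f t - t * f 1| ≤ 1 := by
    intro n hnpos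
    have hn0 : (0 : ℝ) < n := by exact_mod_cast hnpos
    have hn1 : (1 : ℝ) ≤ n := by exact_mod_cast hnpos
    set k := ⌊n * t⌋₊ with hk
    have hk1 : (k : ℝ) ≤ n * t := Nat.floor_le (by positivity)
    have hk2 : n * t < k + 1 := Nat.lt_floor_add_one _
    obtain ⟨r, hr⟩ : ∃ r : ℝ, r = n * t - k := ⟨_, rfl⟩
    have hr0 : 0 ≤ r := by linarith
    have hr1 : r ≤ 1 := by linarith
    have hdec : t = k * (1 / n) + r / n := by
      rw [hr]; field_simp; ring
    have hrn : 0 ≤ r / n := by positivity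
    have a1 : f t = f (k * (1 / n)) + f (r / n) := by
      conv_lhs => rw [hdec]
      exact ha _ _ (by positivity) hrn (by rw [← hdec]; exact h1)
    have a2 : f (k * (1 / n)) = k * f (1 / n) := hn k _ (by positivity) (by linarith)
    have a3 : f 1 = n * f (1 / n) := by
      have h := hn n (1 / n) (by positivity) (by rw [mul_one_div_cancel hn0.ne'])
      rwa [mul_one_div_cancel hn0.ne'] at h
    have a4 : f r = n * f (r / n) := by
      have h := hn n (r / n) hrn (by rw [mul_div_cancel₀ _ hn0.ne']; exact hr1)
      rwa [mul_div_cancel₀ _ hn0.ne'] at h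
    have a5 : n * (f t - t * f 1) = f r - r * f 1 := by
      have : n * t = k + r := by linarith
      calc n * (f t - t * f 1) = n * f t - (n * t) * f 1 := by ring
        _ = f r - r * f 1 := by rw [this, a1, a2, a4, a3]; ring
    rw [← abs_of_pos hn0, ← abs_mul, a5, abs_le]
    have b1 := hb r hr0 hr1
    have b2 := hb 1 (by norm_num) le_rfl
    constructor <;> nlinarith [mul_nonneg hr0 b2.1, mul_le_mul hr1 b2.2 b2.1 zero_le_one]
  by_contra hne
  have hpos : 0 < |f t - t * f 1| := abs_pos.mpr (sub_ne_zero.mpr hne)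
  obtain ⟨n, hn'⟩ := exists_nat_gt (1 / |f t - t * f 1|)
  have hnp : 0 < n := by
    have : (0 : ℝ) < n := lt_trans (by positivity) hn'
    exact_mod_cast this
  have := key n hnp
  rw [div_lt_iff₀ hpos] at hn'
  linarith

/-- A frame function is homogeneous on the effect space:
`v(α • e) = α * v(e)` for `e ∈ 𝓔` and `α ∈ [0,1]`. -/
theorem frameFunction_homogeneous {d : ℕ} (hd : 1 ≤ d)
    (E : Set (EuclideanSpace ℝ (Fin (d + 1)))) (hE : IsEffectSpace E)
    (v : EuclideanSpace ℝ (Fin (d + 1)) → ℝ) (hv : IsFrameFunction E v)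
    (e : EuclideanSpace ℝ (Fin (d + 1))) (he : e ∈ E)
    (α : ℝ) (hα0 : 0 ≤ α) (hα1 : α ≤ 1) :
    v (α • e) = α * v e := by
  obtain ⟨-, hconv, -, h0, hu, hsub⟩ := hE
  obtain ⟨hv1, hv2⟩ := hv
  have hs : ∀ t : ℝ, 0 ≤ t → t ≤ 1 → t • e ∈ E := fun t a b =>
    hconv.smul_mem_of_zero_mem h0 he ⟨a, b⟩
  have h := aux_additive_homog (fun t => v (t • e)) (fun t a b => hv1 _ (hs t a b)) ?_ α hα0 hα1
  · simpa using h
  intro s t hs0 ht0 hst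
  have m1 := hs s hs0 (by linarith)
  have m2 := hs t ht0 (by linarith)
  have m3 := hs (s + t) (by linarith) hst
  have o2 := hv2 2 ![(s + t) • e, unitEffect d - (s + t) • e] ?_
  have o3 := hv2 3 ![s • e, t • e, unitEffect d - (s + t) • e] ?_
  · simp [Fin.sum_univ_succ] at o2 o3
    linarith
  · refine ⟨?_, ?_, ?_⟩
    · intro j
      fin_cases j
      · exact m1
      · exact m2
      · exact hsub _ m3
    · simp [Fin.sum_univ_succ, add_smul]
      abel
    · intro J
      have hJ : ∑ j ∈ J, (![s • e, t • e, unitEffect d - (s + t) • e] : Fin 3 → _) j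
          = (if (0 : Fin 3) ∈ J then s • e else 0) + ((if (1 : Fin 3) ∈ J then t • e else 0)
            + (if (2 : Fin 3) ∈ J then unitEffect d - (s + t) • e else 0)) := by
        have hf : J = Finset.univ.filter (fun j => j ∈ J) := by ext; simp
        conv_lhs => rw [hf]
        rw [Finset.sum_filter]
        rw [Fin.sum_univ_three, add_assoc]
        rfl
      rw [hJ]
      have q1 : s • e + (unitEffect d - (s + t) • e) = unitEffect d - t • e := by
        rw [add_smul]; abel
      have q2 : t • e + (unitEffect d - (s + t) • e) = unitEffect d - s • e := by
        rw [add_smul]; abel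
      have q4 : s • e + (unitEffect d - s • e) = unitEffect d := by abel
      split_ifs <;> simp only [add_zero, zero_add, q1, q2, q4, ← add_smul] <;>
        first
        | assumption
        | exact hsub _ m1
        | exact hsub _ m2
        | exact hsub _ m3
  · refine ⟨?_, ?_, ?_⟩
    · intro j
      fin_cases j
      · exact m3
      · exact hsub _ m3
    · simp [Fin.sum_univ_succ]
    · intro J
      have hJ : ∑ j ∈ J, (![(s + t) • e, unitEffect d - (s + t) • e] : Fin 2 → _) j
          = (if (0 : Fin 2) ∈ J then (s + t) • e else 0)
            + (if (1 : Fin 2) ∈ J then unitEffect d - (s + t) • e else 0) := by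
        have hf : J = Finset.univ.filter (fun j => j ∈ J) := by ext; simp
        conv_lhs => rw [hf]
        rw [Finset.sum_filter]
        rw [Fin.sum_univ_two]
        rfl
      rw [hJ]
      split_ifs <;> simp only [add_zero, zero_add, add_sub_cancel] <;>
        first
        | assumption
        | exact hsub _ m3
end

section
/- Let (𝒮, 𝓔) be a noisy unrestricted GPT system. Then any simulable frame function v on 𝓔 admits an expression v(e) = ⟨e, ω⟩ for some state ω ∈ 𝒮 and all effects e ∈ 𝓔. -/
open scoped RealInnerProductSpace

/-- A dichotomic extremal observable of length `N`: for some extreme point `f` of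
`𝓔` and indices `i ≠ j`, the tuple has `f` at `i`, `u − f` at `j` and `0`
elsewhere. -/
def IsDichotomicExtremal {d : ℕ} (E : Set (EuclideanSpace ℝ (Fin (d + 1)))) {N : ℕ}
    (D : Fin N → EuclideanSpace ℝ (Fin (d + 1))) : Prop :=
  ∃ f ∈ Set.extremePoints ℝ E, ∃ i j : Fin N, i ≠ j ∧ D i = f ∧
    D j = unitEffect d - f ∧ ∀ k, k ≠ i → k ≠ j → D k = 0

/-- A classical mixture of dichotomic extremal observables of length `N`. -/
def IsMixtureOfDichotomic {d : ℕ} (E : Set (EuclideanSpace ℝ (Fin (d + 1)))) {N : ℕ}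
    (M : Fin N → EuclideanSpace ℝ (Fin (d + 1))) : Prop :=
  ∃ m : ℕ, 1 ≤ m ∧ ∃ lam : Fin m → ℝ, (∀ i, 0 ≤ lam i) ∧ (∑ i, lam i = 1) ∧
    ∃ D : Fin m → Fin N → EuclideanSpace ℝ (Fin (d + 1)),
      (∀ i, IsDichotomicExtremal E (D i)) ∧ ∀ k, M k = ∑ i, lam i • D i k

/-- A simulable observable: an `n`-outcome tuple of effects obtained by classical
post-processing of a classical mixture of dichotomic extremal observables. -/
def IsSimulableObservable {d : ℕ} (E : Set (EuclideanSpace ℝ (Fin (d + 1)))) {n : ℕ}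
    (e : Fin n → EuclideanSpace ℝ (Fin (d + 1))) : Prop :=
  (∀ k, e k ∈ E) ∧ ∃ N : ℕ, ∃ M : Fin N → EuclideanSpace ℝ (Fin (d + 1)),
    IsMixtureOfDichotomic E M ∧ ∃ q : Fin n → Fin N → ℝ,
      (∀ k j, 0 ≤ q k j) ∧ (∀ j, ∑ k, q k j = 1) ∧
      ∀ k, e k = ∑ j, q k j • M j

/-- A simulable frame function on `𝓔`: (S1) takes values in `[0,1]` on `𝓔`,
(S2) sums to `1` on every simulable observable. -/
def IsSimulableFrameFunction {d : ℕ} (E : Set (EuclideanSpace ℝ (Fin (d + 1))))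
    (v : EuclideanSpace ℝ (Fin (d + 1)) → ℝ) : Prop :=
  (∀ e ∈ E, 0 ≤ v e ∧ v e ≤ 1) ∧
    ∀ (n : ℕ) (e : Fin n → EuclideanSpace ℝ (Fin (d + 1))),
      IsSimulableObservable E e → ∑ k, v (e k) = 1

theorem minkowski_aux (n : ℕ) : ∀ (V : Type) [NormedAddCommGroup V] [NormedSpace ℝ V]
    [FiniteDimensional ℝ V], Module.finrank ℝ V = n → ∀ K : Set V, IsCompact K → Convex ℝ K →
    K ⊆ convexHull ℝ (K.extremePoints ℝ) := by
  induction n using Nat.strong_induction_on with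
  | _ n ih =>
  intro V _ _ _ hn K hK hKc x hx
  by_contra hxC
  have hcl := closure_convexHull_extremePoints hK hKc
  set C := convexHull ℝ (K.extremePoints ℝ) with hC
  have hCc : Convex ℝ C := convex_convexHull _ _
  have key : ∃ f : StrongDual ℝ V, f ≠ 0 ∧ ∀ a ∈ K, f a ≤ f x := by
    by_cases hint : (interior C).Nonempty
    · obtain ⟨f, hf0, hf⟩ := geometric_hahn_banach_of_nonempty_interior_point hCc
        (fun h => hxC (interior_subset h)) hint
      refine ⟨f, hf0, fun a ha => ?_⟩
      have : closure C ⊆ {y | f y ≤ f x} :=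
        closure_minimal hf (isClosed_le f.continuous continuous_const)
      exact this (hcl ▸ ha)
    · have hCne : C.Nonempty := by
        rw [← closure_nonempty_iff, hcl]; exact ⟨x, hx⟩
      have h1 : affineSpan ℝ C ≠ ⊤ := by
        rwa [hCc.interior_nonempty_iff_affineSpan_eq_top] at hint
      have h2 : vectorSpan ℝ C ≠ ⊤ := by
        intro h; exact h1 ((AffineSubspace.affineSpan_eq_top_iff_vectorSpan_eq_top_of_nonempty ℝ V V hCne).2 h)
      obtain ⟨g, hg0, hg⟩ := Submodule.exists_le_ker_of_lt_top _ (lt_top_iff_ne_top.2 h2)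
      obtain ⟨c, hc⟩ := hCne
      let f : StrongDual ℝ V := LinearMap.toContinuousLinearMap g
      have : closure C ⊆ {y | f y = f c} := by
        refine closure_minimal ?_ (isClosed_eq f.continuous continuous_const)
        intro y hy
        have := hg (vsub_mem_vectorSpan ℝ hy hc)
        simp only [vsub_eq_sub, LinearMap.mem_ker, map_sub, sub_eq_zero] at this
        exact this
      rw [hcl] at this
      refine ⟨f, ?_, fun a ha => ?_⟩
      · intro h; apply hg0; ext y; exact DFunLike.congr_fun h y
      · exact ((this ha).trans (this hx).symm).le
  obtain ⟨f, hf0, hf⟩ := key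
  let W := LinearMap.ker (f : V →ₗ[ℝ] ℝ) 
  have hW : Module.finrank ℝ W < n := by
    rw [← hn]
    apply Submodule.finrank_lt
    intro h
    apply hf0
    ext y
    have : y ∈ W := h ▸ Submodule.mem_top
    simpa [W] using this
  let K' : Set W := {z | x + (z : V) ∈ K}
  have hK' : IsCompact K' := by
    have h1 : Topology.IsClosedEmbedding (fun z : W => x + (z : V)) :=
      (Homeomorph.addLeft x).isClosedEmbedding.comp
        (W.closed_of_finiteDimensional.isClosedEmbedding_subtypeVal)
    exact h1.isCompact_preimage hK
  let φ : W →ᵃ[ℝ] V := AffineMap.const ℝ W x + W.subtype.toAffineMap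
  have hφ : ∀ z, φ z = x + (z : V) := fun z => rfl
  have hKc' : Convex ℝ K' := hKc.affine_preimage φ
  have h0 := ih _ hW W rfl K' hK' hKc' (show (0 : W) ∈ K' by simpa [K'] using hx)
  have h1 : φ 0 ∈ convexHull ℝ (φ '' K'.extremePoints ℝ) := by
    rw [← AffineMap.image_convexHull]; exact ⟨0, h0, rfl⟩
  have h2 : φ '' K'.extremePoints ℝ ⊆ K.extremePoints ℝ := by
    rintro _ ⟨z, hz, rfl⟩
    rw [mem_extremePoints_iff_left] at hz ⊢
    refine ⟨hz.1, ?_⟩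
    rintro y₁ hy₁ y₂ hy₂ ⟨a, b, ha, hb, hab, h⟩
    have hzf : f (z : V) = 0 := z.2
    have e1 : a * f y₁ + b * f y₂ = f x := by
      have := congrArg f h
      simpa [hφ, hzf] using this
    have l1 := hf _ hy₁
    have l2 := hf _ hy₂
    have m1 : f y₁ = f x := by
      have hb' : b = 1 - a := by linarith
      subst hb'
      nlinarith
    have m2 : f y₂ = f x := by
      have ha' : a = 1 - b := by linarith
      subst ha'
      nlinarith
    have k1 : y₁ - x ∈ W := by simp [W, m1]
    have k2 : y₂ - x ∈ W := by simp [W, m2]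
    have := hz.2 ⟨y₁ - x, k1⟩ (by simpa [K'] using hy₁) ⟨y₂ - x, k2⟩ (by simpa [K'] using hy₂)
      ⟨a, b, ha, hb, hab, by
        ext
        have hx' : x = a • x + b • x := by rw [← add_smul, hab, one_smul]
        simp only [Submodule.coe_add, Submodule.coe_smul, smul_sub]
        rw [hφ] at h
        have : (z : V) = a • y₁ + b • y₂ - (a • x + b • x) := by
          rw [h, ← hx']; abel
        rw [this]; abel⟩
    rw [hφ, ← this]; simp
  apply hxC
  have := convexHull_mono h2 h1
  simpa [hφ] using this

theorem affine_sum {V : Type} [AddCommGroup V] [Module ℝ V] {E : Set V} (hE : Convex ℝ E)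
    (h0 : (0 : V) ∈ E) {v : V → ℝ} (v0 : v 0 = 0)
    (hv : ∀ e ∈ E, ∀ f ∈ E, ∀ a b : ℝ, 0 ≤ a → 0 ≤ b → a + b = 1 →
      v (a • e + b • f) = a * v e + b * v f) (s : Finset E) (w : E → ℝ) (hw : ∀ i, 0 ≤ w i)
    (hs : ∑ i ∈ s, w i ≤ 1) : v (∑ i ∈ s, w i • (i : V)) = ∑ i ∈ s, w i * v i := by
  have hcv : ConvexOn ℝ E v := ⟨hE, fun x hx y hy a b ha hb hab => (hv x hx y hy a b ha hb hab).le⟩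
  have hcc : ConcaveOn ℝ E v := ⟨hE, fun x hx y hy a b ha hb hab => (hv x hx y hy a b ha hb hab).ge⟩
  rcases (Finset.sum_nonneg fun i (_ : i ∈ s) => hw i).eq_or_lt with h | h
  · have : ∀ i ∈ s, w i = 0 := (Finset.sum_eq_zero_iff_of_nonneg fun i _ => hw i).1 h.symm
    rw [Finset.sum_eq_zero fun i hi => by rw [this i hi, zero_smul],
      Finset.sum_eq_zero fun i hi => by rw [this i hi, zero_mul], v0]
  · set t := ∑ i ∈ s, w i with ht
    have a1 : ∀ i ∈ s, 0 ≤ w i / t := fun i _ => div_nonneg (hw i) h.le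
    have a2 : ∑ i ∈ s, w i / t = 1 := by rw [← Finset.sum_div, ← ht, div_self h.ne']
    have a3 : ∀ i ∈ s, (i : V) ∈ E := fun i _ => i.2
    have e1 := le_antisymm (hcv.map_sum_le a1 a2 a3) (hcc.le_map_sum a1 a2 a3)
    have m := hE.sum_mem a1 a2 a3
    have e2 := hv _ m 0 h0 t (1 - t) h.le (by linarith) (by ring)
    have e3 : t • ∑ i ∈ s, (w i / t) • (i : V) + (1 - t) • (0 : V) = ∑ i ∈ s, w i • (i : V) := by
      rw [smul_zero, add_zero, Finset.smul_sum]
      refine Finset.sum_congr rfl fun i _ => ?_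
      rw [smul_smul, mul_div_cancel₀ _ h.ne']
    rw [e3, e1, v0, mul_zero, add_zero, Finset.mul_sum] at e2
    rw [e2]
    refine Finset.sum_congr rfl fun i _ => ?_
    rw [smul_eq_mul, ← mul_assoc, mul_div_cancel₀ _ h.ne']

theorem exists_linear_ext {V : Type} [AddCommGroup V] [Module ℝ V] {E : Set V} (hE : Convex ℝ E)
    (h0 : (0 : V) ∈ E) (hsp : Submodule.span ℝ E = ⊤) {v : V → ℝ} (v0 : v 0 = 0)
    (hv : ∀ e ∈ E, ∀ f ∈ E, ∀ a b : ℝ, 0 ≤ a → 0 ≤ b → a + b = 1 →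
      v (a • e + b • f) = a * v e + b * v f) : ∃ L : V →ₗ[ℝ] ℝ, ∀ e ∈ E, v e = L e := by
  let T : (E →₀ ℝ) →ₗ[ℝ] V := Finsupp.linearCombination ℝ (Subtype.val : E → V)
  let G : (E →₀ ℝ) →ₗ[ℝ] ℝ := Finsupp.linearCombination ℝ (fun e : E => v e)
  have hT : LinearMap.range T = ⊤ := by
    rw [Finsupp.range_linearCombination, Subtype.range_coe, hsp]
  have hker : ∀ c, T c = 0 → G c = 0 := by
    intro c hc
    let K : ℝ := ∑ i ∈ c.support, |c i| + 1
    have hK1 : 0 ≤ ∑ i ∈ c.support, |c i| := Finset.sum_nonneg fun i _ => abs_nonneg _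
    have hK : 0 < K := by positivity
    have bd : ∀ g : E → ℝ, (∀ i, g i ≤ |c i|) → ∑ i ∈ c.support, g i / K ≤ 1 := by
      intro g hg
      rw [← Finset.sum_div, div_le_one hK]
      have := Finset.sum_le_sum fun i (_ : i ∈ c.support) => hg i
      simp only [K]; linarith
    have p1 := affine_sum hE h0 v0 hv c.support (fun i => max (c i) 0 / K)
      (fun i => by positivity) (bd _ fun i => max_le (le_abs_self _) (abs_nonneg _))
    have p2 := affine_sum hE h0 v0 hv c.support (fun i => max (-c i) 0 / K)
      (fun i => by positivity) (bd _ fun i => max_le (neg_le_abs _) (abs_nonneg _))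
    have hm : ∀ x : ℝ, max x 0 / K - max (-x) 0 / K = K⁻¹ * x := by
      intro x
      rcases le_total 0 x with h | h
      · rw [max_eq_left h, max_eq_right (by linarith)]; ring
      · rw [max_eq_right h, max_eq_left (by linarith)]; ring
    have q : ∑ i ∈ c.support, (max (c i) 0 / K) • (i : V)
        = ∑ i ∈ c.support, (max (-c i) 0 / K) • (i : V) := by
      rw [← sub_eq_zero, ← Finset.sum_sub_distrib]
      simp_rw [← sub_smul, hm, mul_smul]
      rw [← Finset.smul_sum]
      have : T c = ∑ i ∈ c.support, c i • (i : V) := rfl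
      rw [← this, hc, smul_zero]
    rw [q, p2, eq_comm, ← sub_eq_zero, ← Finset.sum_sub_distrib] at p1
    simp_rw [← sub_mul, hm, mul_assoc] at p1
    rw [← Finset.mul_sum] at p1
    have : G c = ∑ i ∈ c.support, c i * v i := rfl
    rw [this]
    exact (mul_eq_zero.1 p1).resolve_left (inv_ne_zero hK.ne')
  obtain ⟨s, hs⟩ := T.exists_rightInverse_of_surjective hT
  refine ⟨G ∘ₗ s, fun e he => ?_⟩
  have h1 : T (s e) = e := DFunLike.congr_fun hs e
  have h2 : T (Finsupp.single ⟨e, he⟩ 1) = e := by simp [T]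
  have h3 := hker (s e - Finsupp.single ⟨e, he⟩ 1) (by rw [map_sub, h1, h2, sub_self])
  rw [map_sub, sub_eq_zero] at h3
  simp only [LinearMap.comp_apply]
  rw [h3]; simp [G]

theorem additive_unit {h : ℝ → ℝ} (hb : ∀ t, 0 ≤ t → t ≤ 1 → 0 ≤ h t ∧ h t ≤ 1)
    (ha : ∀ s t, 0 ≤ s → 0 ≤ t → s + t ≤ 1 → h (s + t) = h s + h t) (t : ℝ) (t0 : 0 ≤ t)
    (t1 : t ≤ 1) : h t = t * h 1 := by
  rcases t1.eq_or_lt with rfl | t1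
  · simp
  let g : ℝ → ℝ := fun t => h t - t * h 1
  have ga : ∀ s t, 0 ≤ s → 0 ≤ t → s + t ≤ 1 → g (s + t) = g s + g t := by
    intro s t a b c
    simp only [g, ha s t a b c]; ring
  have g1 : g 1 = 0 := by simp [g]
  have h1 := hb 1 zero_le_one le_rfl
  have gb : ∀ t, 0 ≤ t → t ≤ 1 → |g t| ≤ 1 := by
    intro t a b
    have := hb t a b
    rw [abs_le]; simp only [g]
    constructor <;> nlinarith
  have gn : ∀ n : ℕ, ∃ s, 0 ≤ s ∧ s < 1 ∧ g s = n * g t := by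
    intro n
    induction n with
    | zero =>
      refine ⟨0, le_rfl, one_pos, ?_⟩
      have := ga 0 0 le_rfl le_rfl (by norm_num)
      simp only [add_zero] at this
      push_cast; linarith
    | succ n ih =>
      obtain ⟨s, s0, s1, hs⟩ := ih
      by_cases hst : s + t < 1
      · refine ⟨s + t, by linarith, hst, ?_⟩
        rw [ga s t s0 t0 hst.le, hs]; push_cast; ring
      · refine ⟨s + t - 1, by linarith, by linarith, ?_⟩
        have e1 := ga (s + t - 1) (1 - t) (by linarith) (by linarith) (by linarith)
        have e2 := ga t (1 - t) t0 (by linarith) (by linarith)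
        rw [show s + t - 1 + (1 - t) = s by ring] at e1
        rw [show t + (1 - t) = 1 by ring] at e2
        push_cast; linarith
  have : g t = 0 := by
    by_contra hne
    obtain ⟨n, hn⟩ := exists_nat_gt (1 / |g t|)
    obtain ⟨s, s0, s1, hs⟩ := gn n
    have := gb s s0 s1.le
    rw [hs, abs_mul, Nat.abs_cast] at this
    rw [div_lt_iff₀ (abs_pos.2 hne)] at hn
    linarith
  simp only [g] at this
  linarith

theorem mixture_of_mem_convexHull {d : ℕ} {E : Set (EuclideanSpace ℝ (Fin (d + 1)))} {N : ℕ}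
    {M : Fin N → EuclideanSpace ℝ (Fin (d + 1))}
    (hM : M ∈ convexHull ℝ {D : Fin N → EuclideanSpace ℝ (Fin (d + 1)) |
      IsDichotomicExtremal E D}) : IsMixtureOfDichotomic E M := by
  rw [mem_convexHull_iff_exists_fintype] at hM
  obtain ⟨ι, _, w, z, hw, hw1, hz, rfl⟩ := hM
  let σ := Fintype.equivFin ι
  refine ⟨Fintype.card ι, ?_, fun i => w (σ.symm i), fun i => hw _, ?_,
    fun i => z (σ.symm i), fun i => hz _, fun k => ?_⟩
  · rw [Nat.one_le_iff_ne_zero]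
    intro h
    rw [Fintype.card_eq_zero_iff] at h
    simp at hw1
  · rw [← hw1]; exact Equiv.sum_comp σ.symm w
  · rw [Equiv.sum_comp σ.symm (fun i => w i • z i k)]
    simp

theorem mixture_mem {d : ℕ} {E : Set (EuclideanSpace ℝ (Fin (d + 1)))}
    (hE : IsEffectSpace E) (i : Fin 3) (hi : i ≠ 2) {e : EuclideanSpace ℝ (Fin (d + 1))}
    (he : e ∈ E) : (fun k : Fin 3 => if k = i then e else if k = 2 then unitEffect d - e else 0) ∈
      convexHull ℝ {D : Fin 3 → EuclideanSpace ℝ (Fin (d + 1)) | IsDichotomicExtremal E D} := by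
  have h1 := minkowski_aux _ _ rfl E hE.1 hE.2.1 he
  let φ : EuclideanSpace ℝ (Fin (d + 1)) →ᵃ[ℝ] (Fin 3 → EuclideanSpace ℝ (Fin (d + 1))) :=
    AffineMap.pi fun k => if k = i then AffineMap.id ℝ _ else
      if k = 2 then AffineMap.const ℝ _ (unitEffect d) - AffineMap.id ℝ _ else 0
  have hφ : ∀ e, φ e = fun k : Fin 3 => if k = i then e else
      if k = 2 then unitEffect d - e else 0 := by
    intro e
    funext k
    simp only [φ, AffineMap.pi_apply]
    split_ifs <;> simp
  have h2 : φ e ∈ convexHull ℝ (φ '' E.extremePoints ℝ) := by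
    rw [← AffineMap.image_convexHull]; exact ⟨e, h1, rfl⟩
  rw [← hφ]
  refine convexHull_mono ?_ h2
  rintro _ ⟨f, hf, rfl⟩
  refine ⟨f, hf, i, 2, hi, ?_, ?_, ?_⟩
  · simp [hφ]
  · simp [hφ, hi.symm]
  · intro k k1 k2; simp [hφ, k1, k2]

theorem frame_add {d : ℕ} {E : Set (EuclideanSpace ℝ (Fin (d + 1)))}
    (hE : IsEffectSpace E) {v : EuclideanSpace ℝ (Fin (d + 1)) → ℝ}
    (hv : IsSimulableFrameFunction E v) {e f : EuclideanSpace ℝ (Fin (d + 1))}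
    (he : e ∈ E) (hf : f ∈ E) {a b : ℝ} (ha : 0 ≤ a) (hb : 0 ≤ b) (hab : a + b = 1) :
    v (a • e) + v (b • f) + v (unitEffect d - (a • e + b • f)) = 1 ∧
    v (a • e + b • f) + v (unitEffect d - (a • e + b • f)) = 1 := by
  obtain ⟨-, hEc, -, h0, -, hu⟩ := id hE
  have m1 := mixture_mem hE 0 (by decide) he
  have m2 := mixture_mem hE 1 (by decide) hf
  have hM := mixture_of_mem_convexHull ((convex_convexHull ℝ _) m1 m2 ha hb hab)
  generalize hMd : a • (_ : Fin 3 → EuclideanSpace ℝ (Fin (d + 1))) + b • (_ : Fin 3 → EuclideanSpace ℝ (Fin (d + 1))) = M at hM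
  have hMdef := hMd.symm
  have M0 : M 0 = a • e := by simp [hMdef]
  have M1 : M 1 = b • f := by simp [hMdef]
  have M2 : M 2 = unitEffect d - (a • e + b • f) := by
    have : unitEffect d = a • unitEffect d + b • unitEffect d := by
      rw [← add_smul, hab, one_smul]
    simp only [hMdef, Pi.add_apply, Pi.smul_apply]
    simp only [show (2 : Fin 3) ≠ 0 by decide, show (2 : Fin 3) ≠ 1 by decide, if_true, if_false,
      smul_sub]
    conv_rhs => rw [this]
    abel
  have E0 : a • e ∈ E := by
    have := hEc he h0 ha hb hab
    simpa using this
  have E1 : b • f ∈ E := by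
    have := hEc h0 hf ha hb hab
    simpa using this
  have E01 : a • e + b • f ∈ E := hEc he hf ha hb hab
  have E2 := hu _ E01
  constructor
  · have := hv.2 3 M ⟨?_, 3, M, hM, fun k j => if k = j then 1 else 0, ?_, ?_, ?_⟩
    · rw [Fin.sum_univ_three, M0, M1, M2] at this
      exact this
    · intro k; fin_cases k
      · simpa [M0] using E0
      · simpa [M1] using E1
      · simpa [M2] using E2
    · intro k j; dsimp only; split_ifs <;> norm_num
    · intro j; simp
    · intro k; simp
  · have := hv.2 2 ![M 0 + M 1, M 2] ⟨?_, 3, M, hM,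
      ![![1, 1, 0], ![0, 0, 1]], ?_, ?_, ?_⟩
    · rw [Fin.sum_univ_two] at this
      simpa [M0, M1, M2] using this
    · intro k; fin_cases k
      · simpa [M0, M1] using E01
      · simpa [M2] using E2
    · intro k j; fin_cases k <;> fin_cases j <;> simp
    · intro j; fin_cases j <;> simp
    · intro k; fin_cases k <;> simp [Fin.sum_univ_three]

/-- In a noisy unrestricted GPT system, every simulable frame
function is represented by a state `ω ∈ 𝒮`. -/
theorem simulable_frame_function_representation {d : ℕ} (hd : 1 ≤ d)
    (S E : Set (EuclideanSpace ℝ (Fin (d + 1))))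
    (hS : IsStateSpace S) (hE : IsEffectSpace E) (hSE : E ⊆ Emap S)
    (hnu : IsNU S E)
    (v : EuclideanSpace ℝ (Fin (d + 1)) → ℝ) (hv : IsSimulableFrameFunction E v) :
    ∃ ω ∈ S, ∀ e ∈ E, v e = ⟪e, ω⟫ := by
  obtain ⟨hEk, hEc, hEs, h0, hu, hu'⟩ := id hE
  have hadd : ∀ e ∈ E, ∀ f ∈ E, ∀ a b : ℝ, 0 ≤ a → 0 ≤ b → a + b = 1 →
      v (a • e + b • f) = v (a • e) + v (b • f) := by
    intro e he f hf a b ha hb hab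
    have := frame_add hE hv he hf ha hb hab
    linarith [this.1, this.2]
  have v0 : v 0 = 0 := by
    have := hadd 0 h0 0 h0 0 1 le_rfl zero_le_one (by norm_num)
    simp only [smul_zero, add_zero] at this
    linarith
  have vu : v (unitEffect d) = 1 := by
    have := (frame_add hE hv h0 h0 le_rfl zero_le_one (zero_add 1)).2
    simp only [smul_zero, add_zero, sub_zero] at this
    linarith
  have smem : ∀ e ∈ E, ∀ t : ℝ, 0 ≤ t → t ≤ 1 → t • e ∈ E := by
    intro e he t h1 h2
    have := hEc he h0 h1 (sub_nonneg.2 h2) (by ring)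
    simpa using this
  have hom : ∀ e ∈ E, ∀ t : ℝ, 0 ≤ t → t ≤ 1 → v (t • e) = t * v e := by
    intro e he t h1 h2
    have := additive_unit (h := fun t => v (t • e)) (fun t a b => hv.1 _ (smem e he t a b)) ?_ t h1 h2
    · simpa using this
    · intro s t hs ht hst
      rcases (add_nonneg hs ht).eq_or_lt with h | h
      · have : s = 0 := by linarith
        have : t = 0 := by linarith
        subst s t; simp [v0]
      · have hm := smem e he (s + t) h.le hst
        have := hadd _ hm _ hm (s / (s + t)) (t / (s + t)) (by positivity) (by positivity)
          (by rw [← add_div, div_self h.ne'])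
        simp only [smul_smul, div_mul_cancel₀ _ h.ne'] at this
        simp only [add_smul]
        exact this
  obtain ⟨L, hL⟩ := exists_linear_ext hEc h0 hEs v0 (fun e he f hf a b ha hb hab => by
    rw [hadd e he f hf a b ha hb hab, hom e he a ha (by linarith), hom f hf b hb (by linarith)])
  let ω := (InnerProductSpace.toDual ℝ (EuclideanSpace ℝ (Fin (d + 1)))).symm
    (LinearMap.toContinuousLinearMap L)
  have hω : ∀ e, L e = ⟪e, ω⟫ := by
    intro e
    rw [real_inner_comm, InnerProductSpace.toDual_symm_apply]
    rfl
  refine ⟨ω, ?_, fun e he => by rw [hL e he, hω]⟩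
  by_contra hωS
  obtain ⟨hSn, hSk, hSc, hSu⟩ := hS
  obtain ⟨f, c, hfc, hcω⟩ := geometric_hahn_banach_closed_point hSc hSk.isClosed hωS
  let x := (InnerProductSpace.toDual ℝ (EuclideanSpace ℝ (Fin (d + 1)))).symm f
  have hx : ∀ y, ⟪x, y⟫ = f y := fun y => InnerProductSpace.toDual_symm_apply
  obtain ⟨B, hB⟩ := hSk.bddBelow_image f.continuous.continuousOn
  obtain ⟨s0, hs0⟩ := hSn
  have hB' : ∀ s ∈ S, B ≤ f s := fun s hs => hB ⟨s, hs, rfl⟩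
  have hcB : 0 < c - B := by linarith [hB' s0 hs0, hfc s0 hs0]
  let t : ℝ := (c - B)⁻¹
  have ht : 0 < t := inv_pos.2 hcB
  have hin : ∀ y, ⟪unitEffect d, y⟫ = 1 → ⟪t • (c • unitEffect d - x), y⟫ = t * (c - f y) := by
    intro y hy
    rw [real_inner_smul_left, inner_sub_left, real_inner_smul_left, hy, hx, mul_one]
  obtain ⟨p, hp, -, hpE⟩ := hnu (t • (c • unitEffect d - x)) (by
    intro s hs
    rw [hin s (hSu s hs)]
    constructor
    · exact mul_nonneg ht.le (by linarith [hfc s hs])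
    · calc t * (c - f s) ≤ t * (c - B) := mul_le_mul_of_nonneg_left (by linarith [hB' s hs]) ht.le
        _ = 1 := inv_mul_cancel₀ hcB.ne')
  have h1 := (hv.1 _ hpE).1
  rw [hL _ hpE, hω, real_inner_smul_left, hin ω (by rw [← hω, ← hL _ hu, vu])] at h1
  have : t * (c - f ω) < 0 := mul_neg_of_pos_of_neg ht (by linarith)
  have := mul_neg_of_pos_of_neg hp this
  linarith
end

section
/- The Spekkens toy model does not admit a Gleason-type theorem: with 𝒮_S the regular octahedron 𝒮_S = conv{(±1,0,0,1), (0,±1,0,1), (0,0,±1,1)} ⊆ ℝ⁴ and 𝓔_S = conv{(0,0,0,0), (0,0,0,1), (±1,0,0,1)/2, (0,±1,0,1)/2, (0,0,±1,1)/2} ⊆ ℝ⁴, the vector ω₀ = (1,1,1,1) satisfies ω₀ ∈ W(𝓔_S) but ω₀ ∉ 𝒮_S; in particular 𝒮_S is a proper subset of W(𝓔_S). -/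
open scoped RealInnerProductSpace

/-- A vector in `ℝ⁴ = EuclideanSpace ℝ (Fin (3 + 1))` with the given coordinates. -/
noncomputable def vec4 (a b c e : ℝ) : EuclideanSpace ℝ (Fin (3 + 1)) :=
  (WithLp.equiv 2 (Fin (3 + 1) → ℝ)).symm ![a, b, c, e]

/-- The state space of (the convexification of) the Spekkens toy model: a regular
octahedron. -/
noncomputable def spekkensStates : Set (EuclideanSpace ℝ (Fin (3 + 1))) :=
  convexHull ℝ {vec4 1 0 0 1, vec4 (-1) 0 0 1, vec4 0 1 0 1,
    vec4 0 (-1) 0 1, vec4 0 0 1 1, vec4 0 0 (-1) 1}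

/-- The effect space of the Spekkens toy model. -/
noncomputable def spekkensEffects : Set (EuclideanSpace ℝ (Fin (3 + 1))) :=
  convexHull ℝ {vec4 0 0 0 0, vec4 0 0 0 1,
    vec4 (1 / 2) 0 0 (1 / 2), vec4 (-(1 / 2)) 0 0 (1 / 2),
    vec4 0 (1 / 2) 0 (1 / 2), vec4 0 (-(1 / 2)) 0 (1 / 2),
    vec4 0 0 (1 / 2) (1 / 2), vec4 0 0 (-(1 / 2)) (1 / 2)}

theorem inner_vec4 (a b c e : ℝ) (w : EuclideanSpace ℝ (Fin (3 + 1))) :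
    ⟪vec4 a b c e, w⟫ = a * w 0 + b * w 1 + c * w 2 + e * w 3 := by
  simp [vec4, PiLp.inner_apply, Fin.sum_univ_succ]
  ring_nf

theorem inner_unit (w : EuclideanSpace ℝ (Fin (3 + 1))) :
    ⟪unitEffect 3, w⟫ = w 3 := by
  simp [unitEffect, EuclideanSpace.inner_single_left]

theorem vec4_0 (a b c e : ℝ) : vec4 a b c e 0 = a := rfl

theorem vec4_1 (a b c e : ℝ) : vec4 a b c e 1 = b := rfl

theorem vec4_2 (a b c e : ℝ) : vec4 a b c e 2 = c := rfl

theorem vec4_3 (a b c e : ℝ) : vec4 a b c e 3 = e := rfl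

theorem convex_Wmap (E : Set (EuclideanSpace ℝ (Fin (3 + 1)))) : Convex ℝ (Wmap E) := by
  intro x hx y hy a b ha hb hab
  refine ⟨?_, fun e he => ?_⟩
  · rw [inner_add_right, inner_smul_right, inner_smul_right, hx.1, hy.1]; simpa using hab
  · rw [inner_add_right, inner_smul_right, inner_smul_right]
    have := hx.2 e he
    have := hy.2 e he
    positivity

theorem mem_W (w : EuclideanSpace ℝ (Fin (3 + 1))) (h3 : w 3 = 1)
    (h0 : |w 0| ≤ 1) (h1 : |w 1| ≤ 1) (h2 : |w 2| ≤ 1) : w ∈ Wmap spekkensEffects := by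
  refine ⟨by rw [inner_unit, h3], fun e he => ?_⟩
  have hc : Convex ℝ {e : EuclideanSpace ℝ (Fin (3 + 1)) | 0 ≤ ⟪e, w⟫} := by
    intro x hx y hy a b ha hb hab
    simp only [Set.mem_ofPred_eq] at *
    rw [inner_add_left, real_inner_smul_left, real_inner_smul_left]
    positivity
  refine convexHull_min ?_ hc he
  rw [abs_le] at h0 h1 h2
  intro x hx
  simp only [Set.mem_insert_iff, Set.mem_singleton_iff] at hx
  rcases hx with rfl | rfl | rfl | rfl | rfl | rfl | rfl | rfl <;>
    simp only [Set.mem_ofPred_eq, inner_vec4, h3] <;> linarith [h0.1, h0.2, h1.1, h1.2, h2.1, h2.2]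

/-- The Spekkens toy model does not admit a Gleason-type theorem:
the vector `ω₀ = (1,1,1,1)` lies in `W(𝓔_S)` but not in `𝒮_S`; in particular
`𝒮_S` is a proper subset of `W(𝓔_S)`. -/
theorem spekkens_no_gleason_type :
    vec4 1 1 1 1 ∈ Wmap spekkensEffects ∧
    vec4 1 1 1 1 ∉ spekkensStates ∧
    spekkensStates ⊂ Wmap spekkensEffects := by
  have hW : vec4 1 1 1 1 ∈ Wmap spekkensEffects := by
    apply mem_W <;> simp [vec4_0, vec4_1, vec4_2, vec4_3]
  have hS : vec4 1 1 1 1 ∉ spekkensStates := by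
    intro h
    have hc : Convex ℝ {w : EuclideanSpace ℝ (Fin (3 + 1)) | ⟪vec4 1 1 1 0, w⟫ ≤ 1} := by
      intro x hx y hy a b ha hb hab
      simp only [Set.mem_ofPred_eq] at *
      rw [inner_add_right, inner_smul_right, inner_smul_right]
      nlinarith
    have := convexHull_min (t := {w | ⟪vec4 1 1 1 0, w⟫ ≤ 1}) ?_ hc h
    · simp only [Set.mem_ofPred_eq, inner_vec4] at this
      norm_num [vec4_0, vec4_1, vec4_2, vec4_3] at this
    · intro x hx
      simp only [Set.mem_insert_iff, Set.mem_singleton_iff] at hx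
      rcases hx with rfl | rfl | rfl | rfl | rfl | rfl <;>
        simp only [Set.mem_ofPred_eq, inner_vec4] <;> norm_num [vec4_0, vec4_1, vec4_2, vec4_3]
  refine ⟨hW, hS, ?_, fun h => hS (h hW)⟩
  refine convexHull_min ?_ (convex_Wmap _)
  intro x hx
  simp only [Set.mem_insert_iff, Set.mem_singleton_iff] at hx
  rcases hx with rfl | rfl | rfl | rfl | rfl | rfl <;> apply mem_W <;> simp [vec4_0, vec4_1, vec4_2, vec4_3]
end
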